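/- Assume the Trudinger–Moser property holds with some constant ω ∈ (0,π] and that f satisfies hypotheses (H). Then the problem (−Δ)^{1/2} u = f(u) in (0,1), u = 0 in ℝ∖(0,1) has a nontrivial weak solution, i.e. there exists u ∈ X with u ≠ 0 (in L²) such that (1/(2π))⟨u,v⟩_X = ∫₀¹ f(u) v dx for all v ∈ X. -/

import Mathlib

open MeasureTheory Real Set Filter Topology

noncomputable section

/-- Integrand of the squared Gagliardo `H^{1/2}` seminorm on `ℝ`. -/
def gagKer (u : ℝ → ℝ) : ℝ × ℝ → ℝ :=
  fun p => (u p.1 - u p.2) ^ 2 / |p.1 - p.2| ^ 2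

/-- Integrand of the Gagliardo inner product `⟨u,v⟩_X`. -/
def innerKer (u v : ℝ → ℝ) : ℝ × ℝ → ℝ :=
  fun p => (u p.1 - u p.2) * (v p.1 - v p.2) / |p.1 - p.2| ^ 2

/-- `u ∈ H^{1/2}(ℝ)` : `u ∈ L²(ℝ)` with finite Gagliardo seminorm. -/
def memH (u : ℝ → ℝ) : Prop :=
  Measurable u ∧ Integrable (fun x => (u x) ^ 2) ∧ Integrable (gagKer u)

/-- Squared Gagliardo seminorm `[u]²`. -/
def gagSq (u : ℝ → ℝ) : ℝ := ∫ p : ℝ × ℝ, gagKer u p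

/-- Gagliardo seminorm `[u]`, i.e. the norm `‖u‖_X`. -/
def gagNorm (u : ℝ → ℝ) : ℝ := Real.sqrt (gagSq u)

/-- Inner product `⟨u, v⟩_X`. -/
def innerX (u v : ℝ → ℝ) : ℝ := ∫ p : ℝ × ℝ, innerKer u v p

/-- `u ∈ X` : `u ∈ H^{1/2}(ℝ)` and `u = 0` a.e. outside `(0,1)`. -/
def memX (u : ℝ → ℝ) : Prop :=
  memH u ∧ ∀ᵐ x : ℝ, x ∉ Ioo (0 : ℝ) 1 → u x = 0

/-- `λ₁ = inf {[u]² : u ∈ X, ‖u‖_{L²(0,1)} = 1}`. -/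
def lam1 : ℝ :=
  sInf { t : ℝ | ∃ u : ℝ → ℝ, memX u ∧ (∫ x in Ioo (0 : ℝ) 1, (u x) ^ 2) = 1 ∧ gagSq u = t }

/-- Trudinger–Moser property with constant `ω`. -/
def TMprop (ω : ℝ) : Prop :=
  ∀ α : ℝ, 0 < α → α < 2 * π * ω →
    ∃ K : ℝ, 0 < K ∧ ∀ u : ℝ → ℝ, memX u → gagNorm u ≤ 1 →
      (∫⁻ x in Ioo (0 : ℝ) 1, ENNReal.ofReal (exp (α * (u x) ^ 2))) ≤ ENNReal.ofReal K

/-- The primitive `F(t) = ∫₀ᵗ f(τ) dτ`. -/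
def primF (f : ℝ → ℝ) : ℝ → ℝ := fun t => ∫ τ in (0 : ℝ)..t, f τ

/-- Hypotheses (H). -/
def HypH (f : ℝ → ℝ) : Prop :=
  Continuous f ∧ f 0 = 0 ∧
  (∃ t₀ > (0 : ℝ), ∃ M > (0 : ℝ),
    ∀ t : ℝ, t₀ ≤ |t| → 0 < primF f t ∧ primF f t ≤ M * |f t|) ∧
  (∀ t : ℝ, t ≠ 0 → 0 < 2 * primF f t ∧ 2 * primF f t ≤ f t * t) ∧
  (Filter.limsup (fun t => primF f t / t ^ 2) (𝓝[≠] (0 : ℝ)) < lam1 / (4 * π)) ∧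
  (∀ α : ℝ, 0 < α →
    Filter.Tendsto (fun t => |f t| * exp (-α * t ^ 2)) (Filter.cocompact ℝ) (𝓝 0))

/-- Hypotheses (H') with Trudinger–Moser constant `ω`. -/
def HypH' (f : ℝ → ℝ) (ω : ℝ) : Prop :=
  Continuous f ∧ f 0 = 0 ∧
  (∃ t₀ > (0 : ℝ), ∃ M > (0 : ℝ),
    ∀ t : ℝ, t₀ ≤ |t| → 0 < primF f t ∧ primF f t ≤ M * |f t|) ∧
  (∀ t : ℝ, t ≠ 0 → 0 < 2 * primF f t ∧ 2 * primF f t ≤ f t * t) ∧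
  (Filter.limsup (fun t => primF f t / t ^ 2) (𝓝[≠] (0 : ℝ)) < lam1 / (4 * π)) ∧
  ∃ α₀ : ℝ, 0 < α₀ ∧ α₀ < 2 * π * ω ∧
    (∀ α : ℝ, 0 < α → α < α₀ →
      Filter.Tendsto (fun t => |f t| * exp (-α * t ^ 2)) (Filter.cocompact ℝ) Filter.atTop) ∧
    (∀ α : ℝ, α₀ < α →
      Filter.Tendsto (fun t => |f t| * exp (-α * t ^ 2)) (Filter.cocompact ℝ) (𝓝 0)) ∧
    ∃ ψ : ℝ → ℝ, memX ψ ∧ gagNorm ψ = 1 ∧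
      ∃ b : ℝ, b < ω / (2 * α₀) ∧ ∀ t : ℝ, 0 < t →
        t ^ 2 / (4 * π) - (∫ x in Ioo (0 : ℝ) 1, primF f (t * ψ x)) ≤ b

/-- `u` is a (weak) solution of `(-Δ)^{1/2} u = f(u)` in `(0,1)`, `u = 0` outside. -/
def IsWeakSolution (f u : ℝ → ℝ) : Prop :=
  memX u ∧ ∀ v : ℝ → ℝ, memX v →
    IntegrableOn (fun x => f (u x) * v x) (Ioo (0 : ℝ) 1) ∧
    innerX u v / (2 * π) = ∫ x in Ioo (0 : ℝ) 1, f (u x) * v x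

/-- The energy functional `φ(u) = ‖u‖_X²/(4π) - ∫₀¹ F(u) dx`. -/
def phi (f u : ℝ → ℝ) : ℝ :=
  gagSq u / (4 * π) - ∫ x in Ioo (0 : ℝ) 1, primF f (u x)

/-- `⟨φ'(u), v⟩ = (1/(2π))⟨u,v⟩_X - ∫₀¹ f(u) v dx`. -/
def phiDeriv (f u v : ℝ → ℝ) : ℝ :=
  innerX u v / (2 * π) - ∫ x in Ioo (0 : ℝ) 1, f (u x) * v x

/-- The Palais–Smale condition at level `c`. -/
def PalaisSmaleAt (f : ℝ → ℝ) (c : ℝ) : Prop :=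
  ∀ u : ℕ → ℝ → ℝ, (∀ n, memX (u n)) →
    Filter.Tendsto (fun n => phi f (u n)) Filter.atTop (𝓝 c) →
    (∃ ε : ℕ → ℝ, Filter.Tendsto ε Filter.atTop (𝓝 0) ∧
      ∀ n, ∀ v : ℝ → ℝ, memX v → gagNorm v ≤ 1 → |phiDeriv f (u n) v| ≤ ε n) →
    ∃ w : ℝ → ℝ, memX w ∧ ∃ g : ℕ → ℕ, StrictMono g ∧
      Filter.Tendsto (fun k => gagNorm (fun x => u (g k) x - w x)) Filter.atTop (𝓝 0)

theorem ekeland_weak {Y : Type*} [MetricSpace Y] [CompleteSpace Y] (Ψ : Y → ℝ) (m ε : ℝ)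
    (hε : 0 < ε) (hm : ∀ y, m ≤ Ψ y)
    (hcl : ∀ x c, IsClosed {y | Ψ y + ε * dist x y ≤ c}) (x0 : Y) :
    ∃ x, Ψ x ≤ Ψ x0 ∧ ∀ y, Ψ x ≤ Ψ y + ε * dist x y := by
  have step : ∀ (n : ℕ) (x : Y), ∃ y, Ψ y + ε * dist x y ≤ Ψ x ∧
      ∀ z, Ψ z + ε * dist x z ≤ Ψ x → Ψ y ≤ Ψ z + (1/2)^n := by
    intro n x
    set A : Set ℝ := Ψ '' {z | Ψ z + ε * dist x z ≤ Ψ x} with hA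
    have hne : A.Nonempty := ⟨Ψ x, x, by simp, rfl⟩
    have hb : BddBelow A := ⟨m, by rintro _ ⟨z, _, rfl⟩; exact hm z⟩
    have hpos : (0:ℝ) < (1/2)^n := by positivity
    obtain ⟨_, ⟨y, hy, rfl⟩, hlt⟩ := exists_lt_of_csInf_lt hne (lt_add_of_pos_right (sInf A) hpos)
    refine ⟨y, hy, fun z hz => ?_⟩
    have := csInf_le hb (show Ψ z ∈ A from ⟨z, hz, rfl⟩)
    linarith
  choose S hS1 hS2 using step
  let y : ℕ → Y := fun n => Nat.rec x0 (fun k z => S k z) n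
  have hy1 : ∀ n, Ψ (y (n+1)) + ε * dist (y n) (y (n+1)) ≤ Ψ (y n) := fun n => hS1 n (y n)
  have hy2 : ∀ n z, Ψ z + ε * dist (y n) z ≤ Ψ (y n) → Ψ (y (n+1)) ≤ Ψ z + (1/2)^n :=
    fun n => hS2 n (y n)
  have htr : ∀ n k, Ψ (y (n+k)) + ε * dist (y n) (y (n+k)) ≤ Ψ (y n) := by
    intro n k
    induction k with
    | zero => simp
    | succ k ih =>
      have h1 := hy1 (n+k)
      have h2 := dist_triangle (y n) (y (n+k)) (y (n+k+1))
      have h3 := mul_le_mul_of_nonneg_left h2 hε.le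
      have e : n + (k+1) = n + k + 1 := by ring
      rw [e]; linarith
  have hanti : Antitone (fun n => Ψ (y n)) := antitone_nat_of_succ_le fun n => by
    have := hy1 n
    have h2 : 0 ≤ ε * dist (y n) (y (n+1)) := by positivity
    linarith
  have hconv := tendsto_atTop_ciInf hanti ⟨m, by rintro _ ⟨n, rfl⟩; exact hm _⟩
  have hcs : CauchySeq y := by
    have hc := hconv.cauchySeq
    rw [Metric.cauchySeq_iff'] at hc ⊢
    intro δ hδ
    obtain ⟨N, hN⟩ := hc (ε * δ) (by positivity)
    refine ⟨N, fun n hn => ?_⟩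
    have h1 := hN n hn
    obtain ⟨k, rfl⟩ := Nat.exists_eq_add_of_le hn
    have h2 := htr N k
    rw [Real.dist_eq, abs_lt] at h1
    rw [dist_comm]
    have : ε * dist (y N) (y (N+k)) < ε * δ := by linarith [h1.1]
    exact lt_of_mul_lt_mul_left this hε.le
  obtain ⟨x, hx⟩ := cauchySeq_tendsto_of_complete hcs
  have hxS : ∀ n, Ψ x + ε * dist (y n) x ≤ Ψ (y n) := by
    intro n
    refine (hcl (y n) (Ψ (y n))).mem_of_tendsto hx ?_
    filter_upwards [eventually_ge_atTop n] with j hj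
    obtain ⟨k, rfl⟩ := Nat.exists_eq_add_of_le hj
    exact htr n k
  refine ⟨x, ?_, fun z => ?_⟩
  · have := hxS 0
    have h2 : 0 ≤ ε * dist (y 0) x := by positivity
    change Ψ x ≤ Ψ (y 0)
    linarith
  · by_contra hcon
    push Not at hcon
    have hz : ∀ n, Ψ x ≤ Ψ z + (1/2)^n := by
      intro n
      have h1 := hxS n
      have h3 := mul_le_mul_of_nonneg_left (dist_triangle (y n) x z) hε.le
      have h4 := hy2 n z (by linarith)
      have h5 := hxS (n+1)
      have h6 : 0 ≤ ε * dist (y (n+1)) x := by positivity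
      linarith
    have hl : Tendsto (fun n : ℕ => Ψ z + (1/2:ℝ)^n) atTop (𝓝 (Ψ z + 0)) :=
      tendsto_const_nhds.add (tendsto_pow_atTop_nhds_zero_of_lt_one (by norm_num) (by norm_num))
    have h7 := ge_of_tendsto' hl hz
    have h2 : 0 ≤ ε * dist x z := by positivity
    linarith

theorem mountain_pass {E : Type*} [NormedAddCommGroup E] [InnerProductSpace ℝ E] [CompleteSpace E]
    (φ : E → ℝ) (G : E → E) (hG : Continuous G)
    (hφ : ∀ u, HasFDerivAt φ (innerSL ℝ (G u)) u) (h0 : φ 0 = 0)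
    (r ρ : ℝ) (hr : 0 < r) (hρ : 0 < ρ) (hs : ∀ u, ‖u‖ = r → ρ ≤ φ u)
    (e : E) (he : r < ‖e‖) (hφe : φ e ≤ 0) :
    ∃ C : ℝ, ∀ ε > 0, ∃ u, ρ ≤ φ u ∧ φ u ≤ C ∧ ‖G u‖ ≤ ε := by
  have hφc : Continuous φ := continuous_iff_continuousAt.2 fun u => (hφ u).continuousAt
  let Y := {p : C(unitInterval, E) // p 0 = 0 ∧ p 1 = e}
  have hYc : IsClosed {p : C(unitInterval, E) | p 0 = 0 ∧ p 1 = e} := by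
    apply IsClosed.inter
    · exact isClosed_eq (ContinuousEvalConst.continuous_eval_const 0) continuous_const
    · exact isClosed_eq (ContinuousEvalConst.continuous_eval_const 1) continuous_const
  have : CompleteSpace Y := hYc.completeSpace_coe
  -- maximum
  have hmax : ∀ p : C(unitInterval, E), ∃ t, ∀ s, φ (p s) ≤ φ (p t) := by
    intro p
    obtain ⟨t, _, ht⟩ := isCompact_univ.exists_isMaxOn (s := (Set.univ : Set unitInterval))
      ⟨0, trivial⟩ (f := fun t => φ (p t)) (hφc.comp p.continuous).continuousOn
    exact ⟨t, fun s => ht (Set.mem_univ s)⟩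
  choose τ hτ using hmax
  let Ψ : Y → ℝ := fun p => φ (p.1 (τ p.1))
  have hΨρ : ∀ p, ρ ≤ Ψ p := by
    intro p
    have hc : Continuous fun t => ‖p.1 t‖ := p.1.continuous.norm
    have : r ∈ Set.range fun t => ‖p.1 t‖ := by
      apply mem_range_of_exists_le_of_exists_ge hc
      · exact ⟨0, by rw [p.2.1]; simpa using hr.le⟩
      · exact ⟨1, by rw [p.2.2]; exact he.le⟩
    obtain ⟨t, ht⟩ := this
    exact (hs _ ht).trans (hτ _ _)
  have hcl : ∀ ε > (0:ℝ), ∀ (x : Y) (c : ℝ), IsClosed {y | Ψ y + ε * dist x y ≤ c} := by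
    intro ε hε x c
    have : {y | Ψ y + ε * dist x y ≤ c} = ⋂ t : unitInterval, {y : Y | φ (y.1 t) + ε * dist x y ≤ c} := by
      ext y
      simp only [Set.mem_ofPred_eq, Set.mem_iInter]
      constructor
      · intro h t
        have := hτ y.1 t
        change φ (y.1 (τ y.1)) + _ ≤ c at h
        linarith
      · intro h; exact h _
    rw [this]
    refine isClosed_iInter fun t => isClosed_le ?_ continuous_const
    have h1 : Continuous fun y : Y => y.1 t := (ContinuousEvalConst.continuous_eval_const t).comp continuous_subtype_val
    exact (hφc.comp h1).add (continuous_const.mul (continuous_const.dist continuous_id))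
  let p0 : Y := ⟨⟨fun t => (t : ℝ) • e, by fun_prop⟩, by simp, by simp⟩
  have hCpos : 0 < Ψ p0 := hρ.trans_le (hΨρ p0)
  refine ⟨Ψ p0, ?_⟩
  -- main claim
  have key : ∀ ε > 0, ∃ u, ρ ≤ φ u ∧ φ u ≤ Ψ p0 ∧
      ρ * (‖G u‖^2 / (1 + ‖G u‖)) ≤ ε * Ψ p0 := by
    intro ε hε
    obtain ⟨p, hp1, hp2⟩ := ekeland_weak Ψ ρ ε hε hΨρ (hcl ε hε) p0
    let V : E → E := fun u => (max (φ u) 0 / (1 + ‖G u‖)) • G u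
    have hV : Continuous V := by
      refine Continuous.smul (Continuous.div (by fun_prop) (by fun_prop) fun u => ?_) hG
      positivity
    have hVn : ∀ t, ‖V (p.1 t)‖ ≤ Ψ p0 := by
      intro t
      have h1 : φ (p.1 t) ≤ Ψ p0 := (hτ p.1 t).trans hp1
      have h2 : max (φ (p.1 t)) 0 ≤ Ψ p0 := max_le h1 hCpos.le
      have h3 : 0 ≤ max (φ (p.1 t)) 0 := le_max_right _ _
      simp only [V]
      rw [norm_smul, Real.norm_eq_abs, abs_of_nonneg (by positivity), div_mul_eq_mul_div,
        div_le_iff₀ (by positivity)]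
      have := norm_nonneg (G (p.1 t))
      nlinarith
    let s : ℕ → ℝ := fun n => 1 / ((n:ℝ) + 1)
    have hspos : ∀ n, 0 < s n := fun n => by positivity
    have hs0 : Tendsto s atTop (𝓝 0) := tendsto_one_div_add_atTop_nhds_zero_nat
    let q : ℕ → Y := fun n => ⟨⟨fun t => p.1 t - s n • V (p.1 t),
        p.1.continuous.sub (continuous_const.smul (hV.comp p.1.continuous))⟩,
      by simp [p.2.1, V, h0], by simp [p.2.2, V, max_eq_right hφe]⟩
    have hd : ∀ n, dist p (q n) ≤ s n * Ψ p0 := by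
      intro n
      change dist p.1 (q n).1 ≤ _
      rw [ContinuousMap.dist_le (by have := hspos n; positivity)]
      intro t
      simp only [q, ContinuousMap.coe_mk]
      rw [dist_eq_norm, sub_sub_cancel, norm_smul, Real.norm_eq_abs, abs_of_pos (hspos n)]
      exact mul_le_mul_of_nonneg_left (hVn t) (hspos n).le
    let t : ℕ → unitInterval := fun n => τ (q n).1
    have hq : ∀ n, Ψ p ≤ φ (p.1 (t n) - s n • V (p.1 (t n))) + ε * (s n * Ψ p0) := by
      intro n
      have h1 := hp2 (q n)
      have h2 := mul_le_mul_of_nonneg_left (hd n) hε.le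
      change Ψ p ≤ φ ((q n).1 (τ (q n).1)) + _
      change Ψ p ≤ φ ((q n).1 (τ (q n).1)) + _ at h1
      linarith
    obtain ⟨a, g, hg, hta⟩ := CompactSpace.tendsto_subseq t
    have hs0g := hs0.comp hg.tendsto_atTop
    have hVt : Tendsto (fun n => V (p.1 (t (g n)))) atTop (𝓝 (V (p.1 a))) :=
      ((hV.comp p.1.continuous).tendsto a).comp hta
    have hpt : Tendsto (fun n => p.1 (t (g n))) atTop (𝓝 (p.1 a)) :=
      (p.1.continuous.tendsto a).comp hta
    have hqt : Tendsto (fun n => p.1 (t (g n)) - s (g n) • V (p.1 (t (g n)))) atTop (𝓝 (p.1 a)) := by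
      have := hpt.sub (hs0g.smul hVt)
      simpa using this
    have hΨa : Ψ p ≤ φ (p.1 a) := by
      have h1 : Tendsto (fun n => φ (p.1 (t (g n)) - s (g n) • V (p.1 (t (g n)))) + ε * (s (g n) * Ψ p0))
          atTop (𝓝 (φ (p.1 a) + ε * (0 * Ψ p0))) :=
        ((hφc.tendsto _).comp hqt).add (tendsto_const_nhds.mul (hs0g.mul tendsto_const_nhds))
      have := ge_of_tendsto' h1 (fun n => hq (g n))
      simpa using this
    have hρa : ρ ≤ φ (p.1 a) := (hΨρ p).trans hΨa
    refine ⟨p.1 a, hρa, (hτ p.1 a).trans hp1, ?_⟩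
    have hstrict : HasStrictFDerivAt φ (innerSL ℝ (G (p.1 a))) (p.1 a) :=
      hasStrictFDerivAt_of_hasFDerivAt_of_continuousAt (f' := fun u => innerSL ℝ (G u))
        (Filter.Eventually.of_forall hφ) ((innerSL ℝ).continuous.comp hG).continuousAt
    have hin : inner ℝ (G (p.1 a)) (V (p.1 a)) ≤ ε * Ψ p0 := by
      have hlim : Tendsto (fun n => inner ℝ (G (p.1 a)) (V (p.1 (t (g n))))) atTop
          (𝓝 (inner ℝ (G (p.1 a)) (V (p.1 a)))) := tendsto_const_nhds.inner hVt
      refine le_of_forall_pos_le_add fun η hη => ?_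
      refine le_of_tendsto hlim ?_
      have hη' : 0 < η / Ψ p0 := by positivity
      have hlo := (hstrict.isLittleO.comp_tendsto (hqt.prodMk_nhds hpt)).bound hη'
      filter_upwards [hlo] with n hn
      have hn2 := hq (g n)
      have hn3 : φ (p.1 (t (g n))) ≤ Ψ p := hτ p.1 _
      have hsn := hspos (g n)
      simp only [Function.comp_apply, sub_sub_cancel_left, innerSL_apply_apply, inner_neg_right,
        real_inner_smul_right, sub_neg_eq_add, norm_neg, norm_smul, Real.norm_eq_abs, abs_of_pos hsn] at hn
      have hn4 := (abs_le.1 hn).1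
      have hn5 : η / Ψ p0 * (s (g n) * ‖V (p.1 (t (g n)))‖) ≤ η * s (g n) := by
        rw [div_mul_eq_mul_div, div_le_iff₀ hCpos]
        have := mul_le_mul_of_nonneg_left (hVn (t (g n))) (mul_pos hη hsn).le
        nlinarith
      have hn6 := (abs_le.1 hn).2
      have : s (g n) * inner ℝ (G (p.1 a)) (V (p.1 (t (g n)))) ≤ s (g n) * (ε * Ψ p0 + η) := by
        nlinarith
      exact le_of_mul_le_mul_left this hsn
    have hVa : inner ℝ (G (p.1 a)) (V (p.1 a)) = φ (p.1 a) * (‖G (p.1 a)‖^2 / (1 + ‖G (p.1 a)‖)) := by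
      simp only [V]
      rw [inner_smul_right, real_inner_self_eq_norm_sq, max_eq_left (by linarith)]
      ring
    rw [hVa] at hin
    refine le_trans (mul_le_mul_of_nonneg_right hρa (by positivity)) hin
  intro ε hε
  obtain ⟨u, h1, h2, h3⟩ := key (ρ * (ε^2/(1+ε)) / Ψ p0) (by positivity)
  refine ⟨u, h1, h2, ?_⟩
  by_contra hcon
  push Not at hcon
  rw [div_mul_cancel₀ _ hCpos.ne'] at h3
  have h4 := le_of_mul_le_mul_left h3 hρ
  rw [div_le_div_iff₀ (by positivity) (by positivity)] at h4
  have : 0 < ‖G u‖ := hε.trans hcon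
  nlinarith [mul_pos hε this]

theorem primF_hasDerivAt {f : ℝ → ℝ} (hf : Continuous f) (t : ℝ) :
    HasDerivAt (primF f) (f t) t :=
  intervalIntegral.integral_hasDerivAt_right (hf.intervalIntegrable _ _)
    (hf.stronglyMeasurableAtFilter _ _) hf.continuousAt

theorem primF_continuous {f : ℝ → ℝ} (hf : Continuous f) : Continuous (primF f) :=
  continuous_iff_continuousAt.2 fun t => (primF_hasDerivAt hf t).continuousAt

theorem primF_zero (f : ℝ → ℝ) : primF f 0 = 0 := by simp [primF]

theorem primF_refl (f : ℝ → ℝ) (t : ℝ) : primF (fun s => - f (-s)) t = primF f (-t) := by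
  simp only [primF]
  rw [intervalIntegral.integral_neg, intervalIntegral.integral_comp_neg (fun x => f x),
    intervalIntegral.integral_symm]
  simp

theorem ratio_mono {f : ℝ → ℝ} (hf : Continuous f) (k : ℕ) (a : ℝ) (ha : 0 < a)
    (h : ∀ s, a ≤ s → k * primF f s ≤ f s * s) (t : ℝ) (ht : a ≤ t) :
    primF f a / a ^ k ≤ primF f t / t ^ k := by
  have hd : ∀ s, 0 < s → HasDerivAt (fun s => primF f s / s ^ k)
      ((f s * s ^ k - primF f s * (k * s ^ (k-1))) / (s^k)^2) s := by
    intro s hs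
    exact (primF_hasDerivAt hf s).div (hasDerivAt_pow k s) (by positivity)
  have hm : MonotoneOn (fun s => primF f s / s ^ k) (Ici a) := by
    apply monotoneOn_of_deriv_nonneg (convex_Ici a)
    · intro s hs
      exact (hd s (ha.trans_le hs)).continuousAt.continuousWithinAt
    · intro s hs
      rw [interior_Ici] at hs
      exact (hd s (ha.trans hs)).differentiableAt.differentiableWithinAt
    · intro s hs
      rw [interior_Ici] at hs
      have hs0 : 0 < s := ha.trans hs
      rw [(hd s hs0).deriv]
      apply div_nonneg _ (by positivity)
      rcases Nat.eq_zero_or_pos k with rfl | hk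
      · have := h s (le_of_lt hs)
        simp at this ⊢
        exact nonneg_of_mul_nonneg_left this hs0
      · obtain ⟨j, rfl⟩ : ∃ j, k = j + 1 := ⟨k - 1, by omega⟩
        have h1 := h s (le_of_lt hs)
        have h2 : 0 ≤ s ^ j * (f s * s - ((j+1 : ℕ):ℝ) * primF f s) := mul_nonneg (by positivity) (by linarith)
        simp only [Nat.add_sub_cancel]
        calc 0 ≤ _ := h2
          _ = _ := by ring
  exact hm (mem_Ici.2 le_rfl) (mem_Ici.2 ht) ht

theorem ratio_mono_abs {f : ℝ → ℝ} (hf : Continuous f) (k : ℕ) (a : ℝ) (ha : 0 < a)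
    (h : ∀ s, a ≤ |s| → k * primF f s ≤ f s * s) (t : ℝ) (ht : a ≤ |t|) :
    min (primF f a) (primF f (-a)) / a ^ k ≤ primF f t / |t| ^ k ∧
    (primF f t / |t|^k = primF f |t| / |t|^k ∨ primF f t / |t|^k = primF f (-|t|) / |t|^k) := by
  rcases le_total 0 t with h0 | h0
  · rw [abs_of_nonneg h0] at ht ⊢
    refine ⟨?_, Or.inl rfl⟩
    have := ratio_mono hf k a ha (fun s hs => h s (hs.trans (le_abs_self s))) t ht
    refine le_trans ?_ this
    gcongr
    exact min_le_left _ _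
  · rw [abs_of_nonpos h0] at ht ⊢
    refine ⟨?_, Or.inr (by simp)⟩
    have := ratio_mono (f := fun s => - f (-s)) (by fun_prop) k a ha (fun s hs => by
      rw [primF_refl]
      have := h (-s) (by rw [abs_neg]; exact hs.trans (le_abs_self s))
      linarith) (-t) ht
    rw [primF_refl, primF_refl, neg_neg] at this
    refine le_trans ?_ this
    gcongr
    exact min_le_right _ _

theorem growth_of_tendsto {f : ℝ → ℝ} (hf : Continuous f)
    (h : ∀ α : ℝ, 0 < α →
    Filter.Tendsto (fun t => |f t| * exp (-α * t ^ 2)) (Filter.cocompact ℝ) (𝓝 0)) :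
    ∀ α > 0, ∃ C > 0, ∀ t, |f t| ≤ C * exp (α * t^2) := by
  intro α hα
  have h1 := (h α hα).eventually_lt_const (show (0:ℝ) < 1 by norm_num)
  obtain ⟨K, hK, hK2⟩ := mem_cocompact.1 h1
  obtain ⟨B, hB⟩ := hK.exists_bound_of_continuousOn hf.continuousOn
  refine ⟨max B 1, by positivity, fun t => ?_⟩
  have he : 1 ≤ exp (α * t^2) := one_le_exp (by positivity)
  by_cases ht : t ∈ K
  · have := hB t ht
    rw [Real.norm_eq_abs] at this
    calc |f t| ≤ max B 1 := this.trans (le_max_left _ _)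
      _ ≤ _ := le_mul_of_one_le_right (by positivity) he
  · have h2 : |f t| * exp (-α * t^2) < 1 := hK2 ht
    have h3 : |f t| = |f t| * exp (-α * t^2) * exp (α * t^2) := by
      rw [mul_assoc, ← exp_add]; simp
    rw [h3]
    have := le_max_right B 1
    gcongr
    linarith

theorem growth_F {f : ℝ → ℝ} (hg : ∀ α > 0, ∃ C > 0, ∀ t, |f t| ≤ C * exp (α * t^2))
    (h2 : ∀ t : ℝ, t ≠ 0 → 0 < 2 * primF f t ∧ 2 * primF f t ≤ f t * t) :
    ∀ α > 0, ∃ C > 0, ∀ t, |primF f t| ≤ C * exp (α * t^2) := by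
  intro α hα
  obtain ⟨C, hC, hb⟩ := hg (α/2) (by positivity)
  refine ⟨C * (1 + 2/α), by positivity, fun t => ?_⟩
  rcases eq_or_ne t 0 with rfl | ht
  · rw [primF_zero]; simp; positivity
  obtain ⟨h3, h4⟩ := h2 t ht
  have h5 : f t * t ≤ |f t| * |t| := by rw [← abs_mul]; exact le_abs_self _
  rw [abs_of_nonneg (by linarith)]
  have h6 : |t| ≤ 1 + t^2 := by nlinarith [sq_abs t, abs_nonneg t, sq_nonneg (|t| - 1)]
  have h7 : α/2 * t^2 ≤ exp (α/2 * t^2) := by linarith [add_one_le_exp (α/2 * t^2)]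
  have h8 : 1 ≤ exp (α/2 * t^2) := one_le_exp (by positivity)
  have h9 : t^2 ≤ 2/α * exp (α/2 * t^2) := by
    rw [div_mul_eq_mul_div, le_div_iff₀ hα]; linarith
  have h10 : |t| ≤ (1 + 2/α) * exp (α/2 * t^2) := by linarith
  have h11 : exp (α * t^2) = exp (α/2 * t^2) * exp (α/2 * t^2) := by rw [← exp_add]; ring_nf
  calc primF f t ≤ |f t| * |t| := by linarith
    _ ≤ (C * exp (α/2 * t^2)) * ((1 + 2/α) * exp (α/2 * t^2)) := by
        gcongr; exact hb t
    _ = _ := by rw [h11]; ring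

theorem AR_const {f : ℝ → ℝ} (t₀ M : ℝ) (hM : 0 < M)
    (h1 : ∀ t : ℝ, t₀ ≤ |t| → 0 < primF f t ∧ primF f t ≤ M * |f t|)
    (h2 : ∀ t : ℝ, t ≠ 0 → 0 < 2 * primF f t ∧ 2 * primF f t ≤ f t * t) (t : ℝ)
    (ht : max t₀ (3*M) ≤ |t|) : 3 * primF f t ≤ f t * t := by
  have ht3 : 3 * M ≤ |t| := (le_max_right _ _).trans ht
  have ht0 : t ≠ 0 := by
    intro h; rw [h] at ht3; simp at ht3; linarith
  obtain ⟨h3, h4⟩ := h2 t ht0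
  obtain ⟨h5, h6⟩ := h1 t ((le_max_left _ _).trans ht)
  have h7 : f t * t = |f t| * |t| := by rw [← abs_mul, abs_of_pos (by linarith)]
  rw [h7]
  nlinarith [abs_nonneg (f t)]

theorem AR_bound {f : ℝ → ℝ} (hf : Continuous f) (t₀ M : ℝ) (hM : 0 < M)
    (h1 : ∀ t : ℝ, t₀ ≤ |t| → 0 < primF f t ∧ primF f t ≤ M * |f t|)
    (h2 : ∀ t : ℝ, t ≠ 0 → 0 < 2 * primF f t ∧ 2 * primF f t ≤ f t * t) :
    ∃ C, 0 ≤ C ∧ ∀ t, 3 * primF f t ≤ f t * t + C := by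
  obtain ⟨B, hB⟩ := (isCompact_Icc (a := -(max t₀ (3*M))) (b := max t₀ (3*M))).exists_bound_of_continuousOn
    (primF_continuous hf).continuousOn
  refine ⟨3 * max B 0, by positivity, fun t => ?_⟩
  rcases le_total (max t₀ (3*M)) |t| with h | h
  · have := AR_const t₀ M hM h1 h2 t h
    have := le_max_right B 0
    linarith
  · have h3 := hB t (by rw [mem_Icc]; exact abs_le.1 h)
    have h4 := (le_abs_self _).trans h3
    have h5 : 0 ≤ f t * t := by
      rcases eq_or_ne t 0 with rfl | h
      · simp
      · have := h2 t h; linarith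
    have := le_max_left B 0
    linarith

theorem F_big {f : ℝ → ℝ} (hf : Continuous f) (t₀ M : ℝ) (hM : 0 < M)
    (h1 : ∀ t : ℝ, t₀ ≤ |t| → 0 < primF f t ∧ primF f t ≤ M * |f t|)
    (h2 : ∀ t : ℝ, t ≠ 0 → 0 < 2 * primF f t ∧ 2 * primF f t ≤ f t * t) (L : ℝ) (hL : 0 < L) :
    ∃ C, ∀ t, L * t^2 - C ≤ primF f t := by
  set T := max t₀ (3*M) with hT
  have hTp : 0 < T := by have := le_max_right t₀ (3*M); linarith
  set c := min (primF f T) (primF f (-T)) / T^3 with hc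
  have hFp : ∀ t, t ≠ 0 → 0 < primF f t := fun t ht => by linarith [(h2 t ht).1]
  have hcp : 0 < c := div_pos (lt_min (hFp _ hTp.ne') (hFp _ (by linarith))) (by positivity)
  set R := max T (L/c) with hR
  have hRp : 0 < R := hTp.trans_le (le_max_left _ _)
  refine ⟨L * R^2, fun t => ?_⟩
  rcases le_total R |t| with h | h
  · have h3 := (ratio_mono_abs hf 3 T hTp (fun s hs => by
      have := AR_const t₀ M hM h1 h2 s hs
      exact_mod_cast this) t ((le_max_left _ _).trans h)).1
    rw [← hc, le_div_iff₀ (by have := hRp.trans_le h; positivity)] at h3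
    have h4 : L ≤ c * |t| := by
      have := (le_max_right T (L/c)).trans h
      rw [div_le_iff₀ hcp] at this
      linarith
    have h5 : L * t^2 ≤ c * |t|^3 := by
      rw [← sq_abs]
      have := mul_le_mul_of_nonneg_right h4 (sq_nonneg |t|)
      linarith [this, show c * |t| * |t|^2 = c * |t|^3 by ring]
    have : 0 ≤ L * R^2 := by positivity
    linarith
  · have h3 : t^2 ≤ R^2 := by rw [← sq_abs t]; gcongr
    have h4 : 0 ≤ primF f t := by
      rcases eq_or_ne t 0 with rfl | h
      · rw [primF_zero]
      · exact (hFp t h).le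
    have := mul_le_mul_of_nonneg_left h3 hL.le
    linarith

theorem limsup_facts {f : ℝ → ℝ} (hf : Continuous f)
    (h2 : ∀ t : ℝ, t ≠ 0 → 0 < 2 * primF f t ∧ 2 * primF f t ≤ f t * t) (l : ℝ)
    (h : Filter.limsup (fun t => primF f t / t ^ 2) (𝓝[≠] (0 : ℝ)) < l) :
    0 < l ∧ ∃ μ < l, 0 < μ ∧ ∃ δ > 0, ∀ t, |t| < δ → primF f t ≤ μ * t^2 := by
  have hFp : ∀ t, t ≠ 0 → 0 < primF f t := fun t ht => by linarith [(h2 t ht).1]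
  have hl0 : 0 ≤ Filter.limsup (fun t => primF f t / t ^ 2) (𝓝[≠] (0 : ℝ)) := by
    rw [limsup_eq]
    apply Real.sInf_nonneg
    intro a ha
    have h3 : ∀ᶠ t in 𝓝[≠] (0:ℝ), t ≠ 0 := self_mem_nhdsWithin
    obtain ⟨t, ht1, ht2⟩ := (h3.and ha).exists
    have := hFp t ht1
    exact le_trans (by positivity) ht2
  have hl : 0 < l := hl0.trans_lt h
  refine ⟨hl, ?_⟩
  obtain ⟨μ, hμ1, hμ2⟩ := exists_between h
  refine ⟨μ, hμ2, hl0.trans_lt hμ1, ?_⟩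
  have hb : IsBoundedUnder (· ≤ ·) (𝓝[≠] (0:ℝ)) (fun t => primF f t / t ^ 2) := by
    refine ⟨max (primF f 1) (primF f (-1)), ?_⟩
    rw [eventually_map]
    have h3 : ∀ᶠ t in 𝓝[≠] (0:ℝ), t ≠ 0 := self_mem_nhdsWithin
    have h4 : ∀ᶠ t in 𝓝[≠] (0:ℝ), |t| < 1 := by
      apply eventually_nhdsWithin_of_eventually_nhds
      have : ContinuousAt (fun t : ℝ => |t|) 0 := continuous_abs.continuousAt
      exact this.eventually_lt_const (by simp)
    filter_upwards [h3, h4] with t ht ht1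
    rcases lt_or_gt_of_ne ht with h5 | h5
    · have := ratio_mono (f := fun s => - f (-s)) (by fun_prop) 2 (-t) (by linarith) (fun s hs => by
        rw [primF_refl]
        have := (h2 (-s) (by intro h; linarith)).2
        push_cast; linarith) 1 (by rw [abs_of_neg h5] at ht1; exact ht1.le)
      rw [primF_refl, primF_refl, neg_neg] at this
      refine le_trans ?_ (le_max_right _ _)
      simpa using this
    · have := ratio_mono hf 2 t h5 (fun s hs => by
        have := (h2 s (by intro h; linarith)).2
        push_cast; linarith) 1 (by rw [abs_of_pos h5] at ht1; exact ht1.le)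
      refine le_trans ?_ (le_max_left _ _)
      simpa using this
  have hev := eventually_lt_of_limsup_lt hμ1 hb
  rw [eventually_nhdsWithin_iff, Metric.eventually_nhds_iff] at hev
  obtain ⟨δ, hδ, hev⟩ := hev
  refine ⟨δ, hδ, fun t ht => ?_⟩
  rcases eq_or_ne t 0 with rfl | h0
  · simp [primF_zero]
  · have := hev (by simpa using ht) h0
    rw [div_lt_iff₀ (by positivity)] at this
    exact this.le

theorem F_small {f : ℝ → ℝ} (hg : ∀ α > 0, ∃ C > 0, ∀ t, |primF f t| ≤ C * exp (α * t^2))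
    (μ δ : ℝ) (hμ : 0 < μ) (hδ : 0 < δ) (h : ∀ t, |t| < δ → primF f t ≤ μ * t^2) :
    ∀ α > 0, ∃ A > 0, ∀ t, primF f t ≤ μ * t^2 + A * (t^4 * exp (α * t^2)) := by
  intro α hα
  obtain ⟨C, hC, hb⟩ := hg α hα
  refine ⟨C / δ^4, by positivity, fun t => ?_⟩
  rcases lt_or_ge |t| δ with h1 | h1
  · have := h t h1
    have : 0 ≤ C / δ^4 * (t^4 * exp (α * t^2)) := by positivity
    linarith
  · have h2 := (le_abs_self _).trans (hb t)
    have h3 : δ^4 ≤ t^4 := by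
      rw [← (show Even 4 by decide).pow_abs t]; gcongr
    have h4 : C * exp (α * t^2) ≤ C / δ^4 * (t^4 * exp (α * t^2)) := by
      rw [← mul_assoc]
      gcongr
      rw [div_mul_eq_mul_div, le_div_iff₀ (by positivity)]
      gcongr
    have : 0 ≤ μ * t^2 := by positivity
    linarith

theorem Q_lemma (Q : ℝ → ℝ → ℝ) (hQ : Continuous (fun p : ℝ × ℝ => Q p.1 p.2)) (h0 : ∀ a, Q a 0 = 0)
    (hg : ∀ α > 0, ∃ C > 0, ∀ a b, |Q a b| ≤ C * exp (α * (a^2 + b^2))) :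
    ∀ α > 0, ∀ ε > 0, ∃ A ≥ 0, ∀ a b, (Q a b)^2 ≤ ε * exp (α * (a^2 + b^2)) + A * b^2 := by
  intro α hα ε hε
  obtain ⟨C, hC, hb⟩ := hg (α/4) (by positivity)
  have hsq : ∀ a b, (Q a b)^2 ≤ C^2 * exp (α/2 * (a^2 + b^2)) := by
    intro a b
    rw [← sq_abs]
    calc |Q a b|^2 ≤ (C * exp (α/4 * (a^2 + b^2)))^2 := by gcongr; exact hb a b
      _ = _ := by rw [mul_pow, ← exp_nat_mul]; congr 2; push_cast; ring
  -- radius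
  obtain ⟨R, hR, hR2⟩ : ∃ R > 0, ∀ s, R^2 ≤ s → C^2 * exp (α/2 * s) ≤ ε * exp (α * s) := by
    refine ⟨2 * C^2 / (ε * α) + 1, by positivity, fun s hs => ?_⟩
    set R0 := 2 * C^2 / (ε * α)
    have hR0 : 0 < R0 := by positivity
    have h1 : R0 ≤ s := by nlinarith
    have h2 : α/2 * s ≤ exp (α/2 * s) := by linarith [add_one_le_exp (α/2 * s)]
    have h3 : exp (α * s) = exp (α/2 * s) * exp (α/2 * s) := by rw [← exp_add]; ring_nf
    have h4 : C^2 ≤ ε * exp (α/2 * s) := by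
      have : C^2 = ε * (α/2 * R0) := by simp only [R0]; field_simp
      rw [this]
      have : α/2 * R0 ≤ α/2 * s := by gcongr
      gcongr
      linarith
    rw [h3, ← mul_assoc]
    gcongr
  have hK : IsCompact (Icc (-R) R ×ˢ Icc (-R) R) := isCompact_Icc.prod isCompact_Icc
  have huc := hK.uniformContinuousOn_of_continuous hQ.continuousOn
  rw [Metric.uniformContinuousOn_iff] at huc
  obtain ⟨δ, hδ, hδ2⟩ := huc (min ε 1) (by positivity)
  obtain ⟨B, hB⟩ := hK.exists_bound_of_continuousOn hQ.continuousOn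
  refine ⟨B^2 / δ^2, by positivity, fun a b => ?_⟩
  have he : 1 ≤ exp (α * (a^2 + b^2)) := one_le_exp (by positivity)
  rcases le_total (R^2) (a^2+b^2) with h | h
  · have := hsq a b
    have := hR2 _ h
    have : 0 ≤ B^2 / δ^2 * b^2 := by positivity
    linarith
  · have ha : a ∈ Icc (-R) R := by
      rw [mem_Icc, ← abs_le]; exact abs_le_of_sq_le_sq (by nlinarith [sq_nonneg b]) hR.le
    have hbR : b ∈ Icc (-R) R := by
      rw [mem_Icc, ← abs_le]; exact abs_le_of_sq_le_sq (by nlinarith [sq_nonneg a]) hR.le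
    have h0R : (0:ℝ) ∈ Icc (-R) R := by rw [mem_Icc]; constructor <;> linarith
    rcases lt_or_ge |b| δ with h1 | h1
    · have := hδ2 (a, b) ⟨ha, hbR⟩ (a, 0) ⟨ha, h0R⟩ (by simpa [Prod.dist_eq] using h1)
      simp only [h0, Real.dist_eq, sub_zero] at this
      have h3 : (Q a b)^2 ≤ ε := by
        rw [← sq_abs]
        have h4 := min_le_left ε 1
        have h5 := min_le_right ε 1
        nlinarith [abs_nonneg (Q a b)]
      have : 0 ≤ B^2 / δ^2 * b^2 := by positivity
      nlinarith
    · have h2 := hB (a, b) ⟨ha, hbR⟩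
      simp only [Real.norm_eq_abs] at h2
      have h3 : (Q a b)^2 ≤ B^2 := by rw [← sq_abs]; gcongr
      have h4 : B^2 ≤ B^2 / δ^2 * b^2 := by
        rw [div_mul_eq_mul_div, le_div_iff₀ (by positivity)]
        have : δ^2 ≤ b^2 := by rw [← sq_abs b]; gcongr
        gcongr
      have : 0 ≤ ε * exp (α * (a^2 + b^2)) := by positivity
      linarith

/-- integral remainder -/
def remQ (f : ℝ → ℝ) (a b : ℝ) : ℝ := (∫ s in (0:ℝ)..1, f (a + s * b)) - f a

theorem remQ_cont {f : ℝ → ℝ} (hf : Continuous f) : Continuous (fun p : ℝ × ℝ => remQ f p.1 p.2) := by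
  unfold remQ
  refine Continuous.sub ?_ (by fun_prop)
  apply intervalIntegral.continuous_parametric_intervalIntegral_of_continuous'
  fun_prop

theorem remQ_zero (f : ℝ → ℝ) (a : ℝ) : remQ f a 0 = 0 := by simp [remQ]

theorem exp_sum_le (α a b s : ℝ) (hα : 0 < α) (h0 : 0 ≤ s) (h1 : s ≤ 1) :
    exp (α / 2 * (a + s * b)^2) ≤ exp (α * (a^2 + b^2)) := by
  apply exp_le_exp.2
  have : (a + s*b)^2 ≤ 2 * (a^2 + b^2) := by
    have h2 : s^2 ≤ 1 := by nlinarith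
    nlinarith [sq_nonneg (a - s*b), mul_nonneg (sub_nonneg.2 h2) (sq_nonneg b)]
  nlinarith

theorem remQ_growth {f : ℝ → ℝ} (hg : ∀ α > 0, ∃ C > 0, ∀ t, |f t| ≤ C * exp (α * t^2)) :
    ∀ α > 0, ∃ C > 0, ∀ a b, |remQ f a b| ≤ C * exp (α * (a^2 + b^2)) := by
  intro α hα
  obtain ⟨C, hC, hb⟩ := hg (α/2) (by positivity)
  have hb' : ∀ a b s, 0 ≤ s → s ≤ 1 → |f (a + s*b)| ≤ C * exp (α * (a^2 + b^2)) := by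
    intro a b s h0 h1
    refine (hb _).trans ?_
    have := exp_sum_le α a b s hα h0 h1
    gcongr
  refine ⟨2 * C, by positivity, fun a b => ?_⟩
  have h1 := intervalIntegral.norm_integral_le_of_norm_le_const (a := 0) (b := 1)
    (f := fun s => f (a + s*b)) (C := C * exp (α * (a^2 + b^2))) (fun s hs => by
      rw [uIoc_of_le zero_le_one] at hs
      exact hb' a b s hs.1.le hs.2)
  have h2 := hb' a b 0 le_rfl zero_le_one
  simp at h1 h2
  unfold remQ
  have := abs_sub (∫ s in (0:ℝ)..1, f (a + s * b)) (f a)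
  linarith

theorem remQ_spec {f : ℝ → ℝ} (hf : Continuous f) (a b : ℝ) :
    primF f (a + b) - primF f a - f a * b = remQ f a b * b := by
  have h1 : primF f (a+b) - primF f a = ∫ s in a..(a+b), f s := by
    unfold primF
    rw [intervalIntegral.integral_interval_sub_left (hf.intervalIntegrable _ _) (hf.intervalIntegrable _ _)]
  have h2 : (∫ s in (0:ℝ)..1, f (a + s * b)) * b = ∫ s in a..(a+b), f s := by
    have := intervalIntegral.mul_integral_comp_add_mul (a := 0) (b := 1) (f := f) b a
    simp only [mul_zero, add_zero, mul_one] at this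
    rw [← this, mul_comm]
    congr 2
    ext s; rw [mul_comm s b]
  rw [h1, ← h2]
  unfold remQ; ring

theorem L2_norm_sq {Ω : Type*} [MeasurableSpace Ω] {μ : Measure Ω} (h : Lp ℝ 2 μ) :
    ‖h‖^2 = ∫ x, (h x)^2 ∂μ := by
  rw [← real_inner_self_eq_norm_sq, L2.inner_def]
  refine integral_congr_ae (Eventually.of_forall fun x => ?_)
  simp [sq]

theorem L2_sq_integrable {Ω : Type*} [MeasurableSpace Ω] {μ : Measure Ω} (h : Lp ℝ 2 μ) :
    Integrable (fun x => (h x)^2) μ :=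
  (memLp_two_iff_integrable_sq (Lp.memLp h).1).1 (Lp.memLp h)

set_option linter.unusedSectionVars false
section abstractPart

variable {Ω : Type*} [MeasurableSpace Ω] {μ : Measure Ω} [IsProbabilityMeasure μ]
  {E : Type*} [NormedAddCommGroup E] [InnerProductSpace ℝ E] (T : E →L[ℝ] Lp ℝ 2 μ)

/-- abstract Trudinger-Moser -/
def AbsTM : Prop := ∀ B > 0, ∃ α > 0, ∃ K > 0, ∀ g : E, ‖g‖ ≤ B →
  Integrable (fun x => exp (α * (T g x)^2)) μ ∧ ∫ x, exp (α * (T g x)^2) ∂μ ≤ K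

variable {T}

theorem abs_meas (g : E) : AEStronglyMeasurable (T g) μ := Lp.aestronglyMeasurable _

theorem abs_exp2 {α K : ℝ} {g h : E}
    (hg : Integrable (fun x => exp (α * (T g x)^2)) μ ∧ ∫ x, exp (α * (T g x)^2) ∂μ ≤ K)
    (hh : Integrable (fun x => exp (α * (T h x)^2)) μ ∧ ∫ x, exp (α * (T h x)^2) ∂μ ≤ K) :
    Integrable (fun x => exp (α / 2 * ((T g x)^2 + (T h x)^2))) μ ∧
      ∫ x, exp (α / 2 * ((T g x)^2 + (T h x)^2)) ∂μ ≤ K := by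
  have hpt : ∀ a b : ℝ, exp (α / 2 * (a^2 + b^2)) ≤ 1/2 * (exp (α * a^2) + exp (α * b^2)) := by
    intro a b
    have h1 : exp (α * a^2) = exp (α/2 * a^2)^2 := by rw [← exp_nat_mul]; congr 1; push_cast; ring
    have h2 : exp (α * b^2) = exp (α/2 * b^2)^2 := by rw [← exp_nat_mul]; congr 1; push_cast; ring
    rw [mul_add, exp_add, h1, h2]
    nlinarith [sq_nonneg (exp (α/2 * a^2) - exp (α/2 * b^2))]
  have hi : Integrable (fun x => 1/2 * (exp (α * (T g x)^2) + exp (α * (T h x)^2))) μ :=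
    (hg.1.add hh.1).const_mul _
  have hint : Integrable (fun x => exp (α / 2 * ((T g x)^2 + (T h x)^2))) μ := by
    refine hi.mono' ?_ (Eventually.of_forall fun x => ?_)
    · have := abs_meas (T := T) g
      have := abs_meas (T := T) h
      have hc : Continuous (fun p : ℝ × ℝ => exp (α / 2 * (p.1^2 + p.2^2))) := by fun_prop
      exact hc.comp_aestronglyMeasurable
        ((abs_meas (T := T) g).prodMk (abs_meas (T := T) h))
    · rw [Real.norm_eq_abs, abs_of_pos (exp_pos _)]
      exact hpt _ _
  refine ⟨hint, ?_⟩
  calc _ ≤ ∫ x, 1/2 * (exp (α * (T g x)^2) + exp (α * (T h x)^2)) ∂μ :=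
        integral_mono hint hi fun x => hpt _ _
    _ = 1/2 * (∫ x, exp (α * (T g x)^2) ∂μ + ∫ x, exp (α * (T h x)^2) ∂μ) := by
        rw [integral_const_mul, integral_add hg.1 hh.1]
    _ ≤ K := by linarith [hg.2, hh.2]

theorem abs_Q (hTM : AbsTM T) (Q : ℝ → ℝ → ℝ) (hQ : Continuous (fun p : ℝ × ℝ => Q p.1 p.2))
    (h0 : ∀ a, Q a 0 = 0)
    (hg : ∀ α > 0, ∃ C > 0, ∀ a b, |Q a b| ≤ C * exp (α * (a^2 + b^2))) (B : ℝ) (hB : 0 < B)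
    (ε : ℝ) (hε : 0 < ε) : ∃ δ > 0, ∀ g h : E, ‖g‖ ≤ B → ‖h‖ ≤ B → ‖T h‖ ≤ δ →
      ∃ R : Lp ℝ 2 μ, (R =ᵐ[μ] fun x => Q (T g x) (T h x)) ∧ ‖R‖ ≤ ε := by
  obtain ⟨α, hα, K, hK, hTM⟩ := hTM B hB
  obtain ⟨A, hA, hAQ⟩ := Q_lemma Q hQ h0 hg (α/2) (by positivity) (ε^2 / (2 * K)) (by positivity)
  refine ⟨ε / (2 * (A + 1)), by positivity, fun g h hgB hhB hT => ?_⟩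
  obtain ⟨hi, hiK⟩ := abs_exp2 (hTM g hgB) (hTM h hhB)
  have hi2 : Integrable (fun x => ε^2/(2*K) * exp (α / 2 * ((T g x)^2 + (T h x)^2)) + A * (T h x)^2) μ :=
    (hi.const_mul _).add ((L2_sq_integrable (T h)).const_mul A)
  have hm : AEStronglyMeasurable (fun x => Q (T g x) (T h x)) μ :=
    hQ.comp_aestronglyMeasurable ((abs_meas g).prodMk (abs_meas h))
  have hi3 : Integrable (fun x => (Q (T g x) (T h x))^2) μ := by
    refine hi2.mono' (hm.pow 2) (Eventually.of_forall fun x => ?_)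
    rw [Real.norm_eq_abs, abs_of_nonneg (sq_nonneg _)]
    exact hAQ _ _
  have hmem : MemLp (fun x => Q (T g x) (T h x)) 2 μ := (memLp_two_iff_integrable_sq hm).2 hi3
  refine ⟨hmem.toLp, hmem.coeFn_toLp, ?_⟩
  apply abs_le_of_sq_le_sq' _ hε.le |>.2
  rw [L2_norm_sq]
  have h1 : ∫ x, ((MemLp.toLp _ hmem : Lp ℝ 2 μ) x)^2 ∂μ = ∫ x, (Q (T g x) (T h x))^2 ∂μ :=
    integral_congr_ae (hmem.coeFn_toLp.mono fun x hx => by simp only [hx])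
  rw [h1]
  have h2 := integral_mono hi3 hi2 (fun x => hAQ _ _)
  rw [integral_add (hi.const_mul _) ((L2_sq_integrable (T h)).const_mul A), integral_const_mul,
    integral_const_mul, ← L2_norm_sq] at h2
  have h3 : ε^2/(2*K) * ∫ x, exp (α / 2 * ((T g x)^2 + (T h x)^2)) ∂μ ≤ ε^2/2 := by
    calc _ ≤ ε^2/(2*K) * K := by gcongr
      _ = ε^2/2 := by field_simp
  have h4 : A * ‖T h‖^2 ≤ ε^2/2 := by
    calc A * ‖T h‖^2 ≤ A * (ε / (2 * (A + 1)))^2 := by gcongr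
      _ = ε^2/2 * (A / (2 * (A+1)^2)) := by field_simp
      _ ≤ ε^2/2 * 1 := by
        gcongr
        rw [div_le_one (by positivity)]
        nlinarith
      _ = ε^2/2 := by ring
  linarith

theorem abs_N (hTM : AbsTM T) {f : ℝ → ℝ} (hf : Continuous f)
    (hg : ∀ α > 0, ∃ C > 0, ∀ t, |f t| ≤ C * exp (α * t^2)) (B : ℝ) (hB : 0 < B) :
    ∃ C > 0, ∀ g : E, ‖g‖ ≤ B → MemLp (fun x => f (T g x)) 2 μ ∧ ∫ x, (f (T g x))^2 ∂μ ≤ C := by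
  obtain ⟨α, hα, K, hK, hTM⟩ := hTM B hB
  obtain ⟨C, hC, hb⟩ := hg (α/2) (by positivity)
  have hpt : ∀ t, (f t)^2 ≤ C^2 * exp (α * t^2) := by
    intro t
    rw [← sq_abs]
    calc |f t|^2 ≤ (C * exp (α/2 * t^2))^2 := by gcongr; exact hb t
      _ = _ := by rw [mul_pow, ← exp_nat_mul]; congr 2; push_cast; ring
  refine ⟨C^2 * K, by positivity, fun g hgB => ?_⟩
  obtain ⟨h1, h2⟩ := hTM g hgB
  have hm : AEStronglyMeasurable (fun x => f (T g x)) μ := hf.comp_aestronglyMeasurable (abs_meas g)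
  have hi : Integrable (fun x => (f (T g x))^2) μ := by
    refine (h1.const_mul (C^2)).mono' (hm.pow 2) (Eventually.of_forall fun x => ?_)
    rw [Real.norm_eq_abs, abs_of_nonneg (sq_nonneg _)]
    exact hpt _
  refine ⟨(memLp_two_iff_integrable_sq hm).2 hi, ?_⟩
  calc _ ≤ ∫ x, C^2 * exp (α * (T g x)^2) ∂μ := integral_mono hi (h1.const_mul _) fun x => hpt _
    _ ≤ _ := by rw [integral_const_mul]; gcongr

theorem abs_memN (hTM : AbsTM T) {f : ℝ → ℝ} (hf : Continuous f)
    (hg : ∀ α > 0, ∃ C > 0, ∀ t, |f t| ≤ C * exp (α * t^2)) (g : E) :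
    MemLp (fun x => f (T g x)) 2 μ := by
  obtain ⟨C, _, h⟩ := abs_N hTM hf hg (‖g‖ + 1) (by positivity)
  exact (h g (by linarith)).1

theorem abs_T_add (g h : E) : T (g + h) =ᵐ[μ] fun x => T g x + T h x := by
  rw [map_add]; exact Lp.coeFn_add _ _

theorem abs_T_smul (c : ℝ) (g : E) : T (c • g) =ᵐ[μ] fun x => c * T g x := by
  rw [map_smul]; exact Lp.coeFn_smul _ _

theorem abs_N_cont (hTM : AbsTM T) {f : ℝ → ℝ} (hf : Continuous f)
    (hg : ∀ α > 0, ∃ C > 0, ∀ t, |f t| ≤ C * exp (α * t^2)) :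
    Continuous (fun g : E => (abs_memN hTM hf hg g).toLp) := by
  rw [Metric.continuous_iff]
  intro g ε hε
  obtain ⟨δ, hδ, H⟩ := abs_Q hTM (fun a b => f (a + b) - f a) (by fun_prop) (by simp) (by
    intro α hα
    obtain ⟨C, hC, hb⟩ := hg (α/2) (by positivity)
    refine ⟨2 * C, by positivity, fun a b => ?_⟩
    have h1 := (hb (a + 1 * b)).trans (mul_le_mul_of_nonneg_left (exp_sum_le α a b 1 hα zero_le_one le_rfl) hC.le)
    have h2 := (hb (a + 0 * b)).trans (mul_le_mul_of_nonneg_left (exp_sum_le α a b 0 hα le_rfl zero_le_one) hC.le)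
    simp only [one_mul, zero_mul, add_zero] at h1 h2
    have := abs_sub (f (a + b)) (f a)
    linarith) (‖g‖ + 1) (by positivity) (ε/2) (by positivity)
  refine ⟨min 1 (δ / (‖T‖ + 1)), by positivity, fun g' hg' => ?_⟩
  rw [dist_eq_norm] at hg'
  have h1 : ‖g' - g‖ < 1 := hg'.trans_le (min_le_left _ _)
  have h2 : ‖g' - g‖ < δ / (‖T‖ + 1) := hg'.trans_le (min_le_right _ _)
  have h3 : ‖T (g' - g)‖ ≤ δ := by
    refine (T.le_opNorm _).trans ?_
    rw [lt_div_iff₀ (by positivity)] at h2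
    nlinarith [norm_nonneg (g' - g)]
  obtain ⟨R, hR1, hR2⟩ := H g (g' - g) (by linarith) (by linarith [norm_nonneg g]) h3
  have : (abs_memN hTM hf hg g').toLp - (abs_memN hTM hf hg g).toLp = R := by
    apply Lp.ext
    have ha := abs_T_add (T := T) g (g' - g)
    rw [add_sub_cancel] at ha
    filter_upwards [Lp.coeFn_sub (abs_memN hTM hf hg g').toLp (abs_memN hTM hf hg g).toLp,
      (abs_memN hTM hf hg g').coeFn_toLp, (abs_memN hTM hf hg g).coeFn_toLp, hR1, ha]
      with x h1 h2 h3 h4 h5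
    rw [h1, h4, Pi.sub_apply, h2, h3, h5]
  rw [dist_eq_norm, this]
  linarith

theorem abs_F_int (hTM : AbsTM T) {F : ℝ → ℝ} (hF : Continuous F)
    (hg : ∀ α > 0, ∃ C > 0, ∀ t, |F t| ≤ C * exp (α * t^2)) (g : E) :
    Integrable (fun x => F (T g x)) μ :=
  (abs_memN hTM hF hg g).integrable one_le_two

theorem abs_inner_N (hTM : AbsTM T) {f : ℝ → ℝ} (hf : Continuous f)
    (hg : ∀ α > 0, ∃ C > 0, ∀ t, |f t| ≤ C * exp (α * t^2)) (g h : E) :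
    Integrable (fun x => f (T g x) * T h x) μ ∧
    inner ℝ (abs_memN hTM hf hg g).toLp (T h) = ∫ x, f (T g x) * T h x ∂μ := by
  refine ⟨(abs_memN hTM hf hg g).integrable_mul (Lp.memLp (T h)), ?_⟩
  rw [L2.inner_def]
  refine integral_congr_ae ?_
  filter_upwards [(abs_memN hTM hf hg g).coeFn_toLp] with x hx
  rw [hx]
  simp [mul_comm]

theorem abs_deriv [CompleteSpace E] (hTM : AbsTM T) {f : ℝ → ℝ} (hf : Continuous f)
    (hg : ∀ α > 0, ∃ C > 0, ∀ t, |f t| ≤ C * exp (α * t^2))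
    (hG : ∀ α > 0, ∃ C > 0, ∀ t, |primF f t| ≤ C * exp (α * t^2)) (g : E) :
    HasFDerivAt (fun g : E => ∫ x, primF f (T g x) ∂μ)
      (innerSL ℝ (ContinuousLinearMap.adjoint T (abs_memN hTM hf hg g).toLp)) g := by
  apply HasFDerivAt.of_isLittleO
  rw [Asymptotics.isLittleO_iff]
  intro ε hε
  obtain ⟨δ, hδ, H⟩ := abs_Q hTM (remQ f) (remQ_cont hf) (remQ_zero f) (remQ_growth hg)
    (‖g‖ + 1) (by positivity) (ε / (‖T‖ + 1)) (by positivity)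
  rw [Metric.eventually_nhds_iff]
  refine ⟨min 1 (δ / (‖T‖ + 1)), by positivity, fun g' hg' => ?_⟩
  rw [dist_eq_norm] at hg'
  have h1 : ‖g' - g‖ < 1 := hg'.trans_le (min_le_left _ _)
  have h2 : ‖g' - g‖ < δ / (‖T‖ + 1) := hg'.trans_le (min_le_right _ _)
  have h3 : ‖T (g' - g)‖ ≤ δ := by
    refine (T.le_opNorm _).trans ?_
    rw [lt_div_iff₀ (by positivity)] at h2
    nlinarith [norm_nonneg (g' - g)]
  obtain ⟨R, hR1, hR2⟩ := H g (g' - g) (by linarith) (by linarith [norm_nonneg g]) h3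
  have key : (∫ x, primF f (T g' x) ∂μ) - (∫ x, primF f (T g x) ∂μ) -
      (innerSL ℝ (ContinuousLinearMap.adjoint T (abs_memN hTM hf hg g).toLp)) (g' - g)
      = inner ℝ R (T (g' - g)) := by
    have hsub : Integrable (fun x => primF f (T g' x) - primF f (T g x)) μ :=
      (abs_F_int hTM (primF_continuous hf) hG g').sub (abs_F_int hTM (primF_continuous hf) hG g)
    rw [innerSL_apply_apply, ContinuousLinearMap.adjoint_inner_left, (abs_inner_N hTM hf hg g (g' - g)).2,
      ← integral_sub (abs_F_int hTM (primF_continuous hf) hG g') (abs_F_int hTM (primF_continuous hf) hG g),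
      ← integral_sub hsub
        (abs_inner_N hTM hf hg g (g' - g)).1, L2.inner_def]
    refine integral_congr_ae ?_
    have ha := abs_T_add (T := T) g (g' - g)
    rw [add_sub_cancel] at ha
    filter_upwards [ha, hR1] with x hx1 hx2
    rw [hx1, hx2, remQ_spec hf]
    simp [mul_comm]
  rw [key]
  refine (norm_inner_le_norm _ _).trans ?_
  calc ‖R‖ * ‖T (g' - g)‖ ≤ (ε / (‖T‖ + 1)) * (‖T‖ * ‖g' - g‖) := by
        gcongr; exact T.le_opNorm _
    _ = ε * (‖T‖ / (‖T‖ + 1)) * ‖g' - g‖ := by ring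
    _ ≤ ε * 1 * ‖g' - g‖ := by
        gcongr
        rw [div_le_one (by positivity)]; linarith
    _ = _ := by ring

/-- abstract compactness -/
def AbsComp (T : E →L[ℝ] Lp ℝ 2 μ) : Prop := ∀ ε > 0, ∃ (k : ℕ) (w : Fin k → Lp ℝ 2 μ), ∃ C > 0,
  ∀ g : E, ‖T g‖^2 ≤ ε * ‖g‖^2 + C * ∑ i, (inner ℝ (w i) (T g))^2

theorem abs_cauchy (hC : AbsComp T) (u : ℕ → E) (B : ℝ) (hB : 0 < B) (hu : ∀ n, ‖u n‖ ≤ B)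
    (U : Ultrafilter ℕ) (ε : ℝ) (hε : 0 < ε) : ∃ s ∈ U, ∀ n ∈ s, ∀ m ∈ s, ‖T (u n - u m)‖ < ε := by
  obtain ⟨k, w, C, hCp, H⟩ := hC (ε^2 / (16 * B^2)) (by positivity)
  have hl : ∀ i, ∃ l : ℝ, Tendsto (fun n => inner ℝ (w i) (T (u n))) U (𝓝 l) := by
    intro i
    have hb : ∀ n, inner ℝ (w i) (T (u n)) ∈ Icc (-(‖w i‖ * (‖T‖ * B))) (‖w i‖ * (‖T‖ * B)) := by
      intro n
      rw [mem_Icc, ← abs_le]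
      refine (abs_real_inner_le_norm _ _).trans ?_
      gcongr
      refine (T.le_opNorm _).trans ?_
      gcongr
      exact hu n
    obtain ⟨l, _, hl⟩ := isCompact_Icc.ultrafilter_le_nhds
      (U.map fun n => inner ℝ (w i) (T (u n))) (by
        rw [le_principal_iff]
        exact Filter.univ_mem' (f := (U : Filter ℕ)) hb)
    exact ⟨l, hl⟩
  choose l hl using hl
  set η := ε / (4 * (C * (k+1) + 1)) with hη
  have hηp : 0 < η := by positivity
  have hev : ∀ᶠ n in (U : Filter ℕ), ∀ i, |inner ℝ (w i) (T (u n)) - l i| < η := by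
    rw [eventually_all]
    intro i
    have := (hl i).eventually (Metric.ball_mem_nhds _ hηp)
    filter_upwards [this] with n hn
    simpa [Real.dist_eq] using hn
  refine ⟨_, hev, fun n hn m hm => ?_⟩
  have h1 := H (u n - u m)
  have h2 : ∑ i, (inner ℝ (w i) (T (u n - u m)))^2 ≤ ∑ i : Fin k, (2 * η)^2 := by
    apply Finset.sum_le_sum
    intro i _
    rw [map_sub, inner_sub_right, ← sq_abs]
    have a1 := abs_lt.1 (hn i)
    have a2 := abs_lt.1 (hm i)
    gcongr
    rw [abs_le]; constructor <;> linarith [a1.1, a1.2, a2.1, a2.2]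
  simp only [Finset.sum_const, Finset.card_univ, Fintype.card_fin, nsmul_eq_mul] at h2
  have h3 : ‖u n - u m‖ ≤ 2 * B := by linarith [norm_sub_le (u n) (u m), hu n, hu m]
  have h4 : ε^2 / (16 * B^2) * ‖u n - u m‖^2 ≤ ε^2/4 := by
    calc _ ≤ ε^2 / (16 * B^2) * (2*B)^2 := by gcongr
      _ = ε^2/4 := by field_simp; ring
  have h5 : C * (k * (2*η)^2) ≤ ε^2/4 := by
    have e1 : C * (k * (2*η)^2) = ε^2/4 * (C * k / (C * (k+1) + 1)^2) := by
      rw [hη]; field_simp; norm_num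
    rw [e1]
    have : C * k / (C * (k+1) + 1)^2 ≤ 1 := by
      rw [div_le_one (by positivity)]
      have : 0 ≤ C * k := by positivity
      nlinarith
    have : 0 ≤ ε^2/4 := by positivity
    nlinarith
  have h6 : ‖T (u n - u m)‖^2 < ε^2 := by
    have := mul_le_mul_of_nonneg_left h2 hCp.le
    nlinarith
  exact lt_of_pow_lt_pow_left₀ 2 hε.le h6

end abstractPart

section abstractPart2

variable {Ω : Type*} [MeasurableSpace Ω] {μ : Measure Ω} [IsProbabilityMeasure μ]
  {E : Type*} [NormedAddCommGroup E] [InnerProductSpace ℝ E] {T : E →L[ℝ] Lp ℝ 2 μ}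

theorem abs_sphere (hTM : AbsTM T) {f : ℝ → ℝ} (hf : Continuous f)
    (hG : ∀ α > 0, ∃ C > 0, ∀ t, |primF f t| ≤ C * exp (α * t^2))
    (c l m : ℝ) (hl : 0 < l) (hm : 0 < m) (hml : m < c * l)
    (hsm : ∀ α > 0, ∃ A > 0, ∀ t, primF f t ≤ m * t^2 + A * (t^4 * exp (α * t^2)))
    (hP : ∀ g : E, l * ‖T g‖^2 ≤ ‖g‖^2) :
    ∃ r > 0, ∃ ρ > 0, ∀ g : E, ‖g‖ = r → ρ ≤ c * ‖g‖^2 - ∫ x, primF f (T g x) ∂μ := by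
  obtain ⟨α, hα, K, hK, hTM'⟩ := hTM 1 one_pos
  obtain ⟨A, hA, hAF⟩ := hsm (α/2) (by positivity)
  set D := A * (8 / α^2) * K with hD
  have hDp : 0 < D := by positivity
  set κ := c - m / l with hκ
  have hκp : 0 < κ := by
    rw [hκ, sub_pos, div_lt_iff₀ hl]; exact hml
  set r := min 1 (κ / (2 * D)) with hr
  have hrp : 0 < r := by positivity
  have hr1 : r ≤ 1 := min_le_left _ _
  have hr2 : r * D ≤ κ / 2 := by
    have : r ≤ κ / (2 * D) := min_le_right _ _
    rw [le_div_iff₀ (by positivity)] at this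
    linarith
  refine ⟨r, hrp, r^2 * (κ/2), by positivity, fun g hg => ?_⟩
  set w := r⁻¹ • g with hw
  have hwn : ‖w‖ ≤ 1 := by
    rw [hw, norm_smul, hg, norm_inv, Real.norm_eq_abs, abs_of_pos hrp, inv_mul_cancel₀ hrp.ne']
  obtain ⟨hi, hiK⟩ := hTM' w hwn
  have hgw : g = r • w := by rw [hw, smul_smul, mul_inv_cancel₀ hrp.ne', one_smul]
  have hTg := abs_T_smul (T := T) r w
  rw [← hgw] at hTg
  have hpt : ∀ y : ℝ, (r*y)^4 * exp (α/2 * (r*y)^2) ≤ r^4 * (8/α^2 * exp (α * y^2)) := by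
    intro y
    have h1 : exp (α/2 * (r*y)^2) ≤ exp (α/2 * y^2) := by
      apply exp_le_exp.2
      have : (r*y)^2 ≤ y^2 := by
        rw [mul_pow]
        have : r^2 ≤ 1 := by nlinarith
        nlinarith [sq_nonneg y]
      nlinarith
    have h2 : y^4 ≤ 8/α^2 * exp (α/2 * y^2) := by
      have h3 := quadratic_le_exp_of_nonneg (x := α/2 * y^2) (by positivity)
      rw [div_mul_eq_mul_div, le_div_iff₀ (by positivity)]
      have : 0 ≤ α/2 * y^2 := by positivity
      nlinarith
    have h3 : exp (α * y^2) = exp (α/2 * y^2) * exp (α/2 * y^2) := by rw [← exp_add]; ring_nf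
    rw [mul_pow, mul_assoc]
    refine mul_le_mul_of_nonneg_left ?_ (by positivity)
    calc y^4 * exp (α/2 * (r*y)^2) ≤ (8/α^2 * exp (α/2 * y^2)) * exp (α/2 * y^2) := by gcongr
      _ = _ := by rw [h3]; ring
  have hi2 : Integrable (fun x => m * (T g x)^2 + A * (r^4 * (8/α^2 * exp (α * (T w x)^2)))) μ :=
    ((L2_sq_integrable (T g)).const_mul _).add (((hi.const_mul _).const_mul _).const_mul _)
  have h1 : ∫ x, primF f (T g x) ∂μ ≤ ∫ x, (m * (T g x)^2 + A * (r^4 * (8/α^2 * exp (α * (T w x)^2)))) ∂μ := by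
    refine integral_mono_ae (abs_F_int hTM (primF_continuous hf) hG g) hi2 ?_
    filter_upwards [hTg] with x hx
    refine (hAF _).trans ?_
    have := hpt (T w x)
    rw [← hx] at this
    gcongr
  rw [integral_add ((L2_sq_integrable (T g)).const_mul _) (((hi.const_mul _).const_mul _).const_mul _),
    integral_const_mul, integral_const_mul, integral_const_mul, integral_const_mul, ← L2_norm_sq] at h1
  have h2 : A * (r^4 * (8/α^2 * ∫ x, exp (α * (T w x)^2) ∂μ)) ≤ r^4 * D := by
    calc _ ≤ A * (r^4 * (8/α^2 * K)) := by gcongr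
      _ = _ := by rw [hD]; ring
  have h3 : m * ‖T g‖^2 ≤ m / l * r^2 := by
    have := hP g
    rw [hg] at this
    rw [div_mul_eq_mul_div, le_div_iff₀ hl]
    nlinarith
  have h4 : r^4 * D ≤ r^2 * (κ/2) := by
    have e : r^4 * D = r^2 * (r * (r * D)) := by ring
    rw [e]
    gcongr
    have : 0 < r * D := by positivity
    nlinarith
  rw [hg]
  have h5 : c * r^2 = κ * r^2 + m / l * r^2 := by rw [hκ]; ring
  nlinarith

theorem abs_far (hTM : AbsTM T) {f : ℝ → ℝ} (hf : Continuous f)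
    (hG : ∀ α > 0, ∃ C > 0, ∀ t, |primF f t| ≤ C * exp (α * t^2))
    (c : ℝ) (hc : 0 < c) (hbig : ∀ L > 0, ∃ C, ∀ t, L * t^2 - C ≤ primF f t)
    (g : E) (hg : T g ≠ 0) (r : ℝ) (hr : 0 < r) :
    ∃ e : E, r < ‖e‖ ∧ c * ‖e‖^2 - ∫ x, primF f (T e x) ∂μ ≤ 0 := by
  have hTg : 0 < ‖T g‖ := norm_pos_iff.2 hg
  have hgn : 0 < ‖g‖ := norm_pos_iff.2 (by rintro rfl; simp at hg)
  obtain ⟨C, hC⟩ := hbig ((c * ‖g‖^2 + 1) / ‖T g‖^2) (by positivity)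
  set t := |C| + 1 + r / ‖g‖ with ht
  have hrg : 0 < r / ‖g‖ := by positivity
  have htp : 0 < t := by positivity
  refine ⟨t • g, ?_, ?_⟩
  · rw [norm_smul, Real.norm_eq_abs, abs_of_pos htp]
    have : r / ‖g‖ < t := by rw [ht]; linarith [abs_nonneg C]
    rwa [div_lt_iff₀ hgn] at this
  · have h1 : ∫ x, ((c * ‖g‖^2 + 1) / ‖T g‖^2 * (T (t • g) x)^2 - C) ∂μ ≤ ∫ x, primF f (T (t • g) x) ∂μ :=
      integral_mono (((L2_sq_integrable _).const_mul _).sub (integrable_const _))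
        (abs_F_int hTM (primF_continuous hf) hG _) fun x => hC _
    rw [integral_sub ((L2_sq_integrable _).const_mul _) (integrable_const _), integral_const_mul,
      ← L2_norm_sq, map_smul, norm_smul, Real.norm_eq_abs, abs_of_pos htp] at h1
    simp only [integral_const, probReal_univ, smul_eq_mul, one_mul] at h1
    have h2 : (c * ‖g‖^2 + 1) / ‖T g‖^2 * (t * ‖T g‖)^2 = (c * ‖g‖^2 + 1) * t^2 := by
      field_simp
    rw [h2] at h1
    have h3 : C ≤ t^2 := by
      have : |C| + 1 ≤ t := by rw [ht]; linarith
      nlinarith [le_abs_self C, abs_nonneg C]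
    rw [map_smul, norm_smul, Real.norm_eq_abs, abs_of_pos htp]
    nlinarith

theorem abs_existence [CompleteSpace E] (hTM : AbsTM T) (hComp : AbsComp T)
    {f : ℝ → ℝ} (hf : Continuous f)
    (hg : ∀ α > 0, ∃ C > 0, ∀ t, |f t| ≤ C * exp (α * t^2))
    (hG : ∀ α > 0, ∃ C > 0, ∀ t, |primF f t| ≤ C * exp (α * t^2))
    (c l m : ℝ) (hc : 0 < c) (hl : 0 < l) (hm : 0 < m) (hml : m < c * l)
    (hsm : ∀ α > 0, ∃ A > 0, ∀ t, primF f t ≤ m * t^2 + A * (t^4 * exp (α * t^2)))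
    (hP : ∀ g : E, l * ‖T g‖^2 ≤ ‖g‖^2)
    (hbig : ∀ L > 0, ∃ C, ∀ t, L * t^2 - C ≤ primF f t)
    (hAR : ∃ C, 0 ≤ C ∧ ∀ t, 3 * primF f t ≤ f t * t + C)
    (g0 : E) (hg0 : T g0 ≠ 0) :
    ∃ g : E, g ≠ 0 ∧ ∀ h : E, Integrable (fun x => f (T g x) * T h x) μ ∧
      2 * c * inner ℝ g h = ∫ x, f (T g x) * T h x ∂μ := by
  set φ : E → ℝ := fun g => c * ‖g‖^2 - ∫ x, primF f (T g x) ∂μ with hφ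
  set N : E → Lp ℝ 2 μ := fun g => (abs_memN hTM hf hg g).toLp with hN
  set G : E → E := fun g => (2 * c) • g - ContinuousLinearMap.adjoint T (N g) with hGd
  have hNc : Continuous N := abs_N_cont hTM hf hg
  have hGc : Continuous G := by
    refine (continuous_const.smul continuous_id).sub ?_
    exact (ContinuousLinearMap.adjoint T).continuous.comp hNc
  have hder : ∀ u, HasFDerivAt φ (innerSL ℝ (G u)) u := by
    intro u
    have h1 := ((hasStrictFDerivAt_norm_sq u).hasFDerivAt.const_mul c).sub (abs_deriv hTM hf hg hG u)
    refine h1.congr_fderiv ?_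
    ext h
    simp [G, N]
    ring
  have hφ0 : φ 0 = 0 := by
    have h1 : ∫ x, primF f (T (0:E) x) ∂μ = ∫ x, (0:ℝ) ∂μ := by
      refine integral_congr_ae ?_
      rw [map_zero]
      filter_upwards [Lp.coeFn_zero ℝ 2 μ] with x hx
      rw [hx]; simp [primF_zero]
    simp only [hφ]
    rw [h1]
    simp
  obtain ⟨r, hr, ρ, hρ, hsph⟩ := abs_sphere hTM hf hG c l m hl hm hml hsm hP
  obtain ⟨e, he1, he2⟩ := abs_far hTM hf hG c hc hbig g0 hg0 r hr
  obtain ⟨C, hC⟩ := mountain_pass φ G hGc hder hφ0 r ρ hr hρ hsph e he1 he2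
  have hsq : ∀ n : ℕ, ∃ u, ρ ≤ φ u ∧ φ u ≤ C ∧ ‖G u‖ ≤ 1 / ((n:ℝ) + 1) := fun n =>
    hC _ (by positivity)
  choose u hu1 hu2 hu3 using hsq
  have hGu : Tendsto (fun n => G (u n)) atTop (𝓝 0) :=
    squeeze_zero_norm hu3 tendsto_one_div_add_atTop_nhds_zero_nat
  have hinG : ∀ g h, inner ℝ (G g) h = 2 * c * inner ℝ g h - inner ℝ (N g) (T h) := by
    intro g h
    simp only [G]
    rw [inner_sub_left, real_inner_smul_left, ContinuousLinearMap.adjoint_inner_left]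
  -- boundedness
  obtain ⟨A, hA0, hA⟩ := hAR
  obtain ⟨B, hB, huB⟩ : ∃ B > 0, ∀ n, ‖u n‖ ≤ B := by
    have hD : ∀ n, c * ‖u n‖^2 ≤ (3 * |C| + A) + ‖u n‖ := by
      intro n
      have h1 : -inner ℝ (G (u n)) (u n) ≤ ‖u n‖ := by
        refine (neg_le_abs _).trans ((abs_real_inner_le_norm _ _).trans ?_)
        have : ‖G (u n)‖ ≤ 1 := (hu3 n).trans (by
          rw [div_le_one (by positivity)]; linarith [Nat.cast_nonneg (α := ℝ) n])
        nlinarith [norm_nonneg (u n)]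
      rw [hinG, real_inner_self_eq_norm_sq, (abs_inner_N hTM hf hg (u n) (u n)).2] at h1
      have h2 : ∫ x, 3 * primF f (T (u n) x) ∂μ ≤ ∫ x, (f (T (u n) x) * T (u n) x + A) ∂μ :=
        integral_mono ((abs_F_int hTM (primF_continuous hf) hG _).const_mul _)
          ((abs_inner_N hTM hf hg (u n) (u n)).1.add (integrable_const _)) fun x => hA _
      rw [integral_const_mul, integral_add (abs_inner_N hTM hf hg (u n) (u n)).1 (integrable_const _)] at h2
      simp only [integral_const, probReal_univ, smul_eq_mul, one_mul] at h2
      have h3 := hu2 n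
      simp only [hφ] at h3
      linarith [le_abs_self C]
    refine ⟨(3 * |C| + A + 1) / c + 1, by positivity, fun n => ?_⟩
    by_contra hcon
    push Not at hcon
    have h1 := hD n
    have hq : 0 ≤ 3 * |C| + A := by positivity
    have hq2 : 0 ≤ (3 * |C| + A + 1) / c := by positivity
    have h2 : (3 * |C| + A + 1) / c < ‖u n‖ := by linarith
    rw [div_lt_iff₀ hc] at h2
    have h3 : 1 < ‖u n‖ := by linarith
    have h4 := mul_lt_mul_of_pos_right h2 (show 0 < ‖u n‖ by linarith)
    nlinarith
  obtain ⟨CN, hCN, hNb⟩ := abs_N hTM hf hg B hB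
  have hNb' : ∀ n, ‖N (u n)‖ ≤ √CN := by
    intro n
    apply Real.le_sqrt_of_sq_le
    rw [L2_norm_sq]
    refine le_trans (le_of_eq ?_) (hNb (u n) (huB n)).2
    refine integral_congr_ae ?_
    filter_upwards [(abs_memN hTM hf hg (u n)).coeFn_toLp] with x hx
    simp only [hN]
    rw [hx]
  set U := Ultrafilter.of (atTop : Filter ℕ) with hU
  have hUle : (U : Filter ℕ) ≤ atTop := Ultrafilter.of_le _
  have hcau : Cauchy (map u U) := by
    rw [Metric.cauchy_iff]
    refine ⟨inferInstance, fun ε hε => ?_⟩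
    set S := 2 * √CN with hS
    have hSp : 0 < S := by positivity
    obtain ⟨s, hs, hsT⟩ := abs_cauchy hComp u B hB huB U (c * ε^2 / S / 2) (by positivity)
    have hev : ∀ᶠ n in (U : Filter ℕ), ‖G (u n)‖ < c * ε^2 / (8 * B) := by
      have := (hGu.norm.mono_left hUle).eventually_lt_const (show ‖(0:E)‖ < c * ε^2 / (8 * B) by
        rw [norm_zero]; positivity)
      exact this
    refine ⟨u '' (s ∩ {n | ‖G (u n)‖ < c * ε^2 / (8 * B)}), image_mem_map (Filter.inter_mem hs hev), ?_⟩
    rintro _ ⟨n, ⟨hn1, hn2⟩, rfl⟩ _ ⟨k, ⟨hk1, hk2⟩, rfl⟩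
    have hn2 : ‖G (u n)‖ < c * ε^2 / (8 * B) := hn2
    have hk2 : ‖G (u k)‖ < c * ε^2 / (8 * B) := hk2
    have h1 := hinG (u n) (u n - u k)
    have h2 := hinG (u k) (u n - u k)
    have h3 : 2 * c * ‖u n - u k‖^2 = inner ℝ (G (u n) - G (u k)) (u n - u k) +
        inner ℝ (N (u n) - N (u k)) (T (u n - u k)) := by
      have e1 : inner ℝ (G (u n) - G (u k)) (u n - u k) =
        inner ℝ (G (u n)) (u n - u k) - inner ℝ (G (u k)) (u n - u k) := inner_sub_left _ _ _
      have e2 : inner ℝ (N (u n) - N (u k)) (T (u n - u k)) =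
        inner ℝ (N (u n)) (T (u n - u k)) - inner ℝ (N (u k)) (T (u n - u k)) := inner_sub_left _ _ _
      have e3 : ‖u n - u k‖^2 = inner ℝ (u n) (u n - u k) - inner ℝ (u k) (u n - u k) := by
        rw [← inner_sub_left, real_inner_self_eq_norm_sq]
      rw [e1, e2, e3, h1, h2]
      ring
    have h4 : inner ℝ (G (u n) - G (u k)) (u n - u k) ≤ c * ε^2 / 2 := by
      refine (real_inner_le_norm _ _).trans ?_
      have a1 : ‖G (u n) - G (u k)‖ ≤ 2 * (c * ε^2 / (8 * B)) := by
        linarith [norm_sub_le (G (u n)) (G (u k))]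
      have a2 : ‖u n - u k‖ ≤ 2 * B := by linarith [norm_sub_le (u n) (u k), huB n, huB k]
      calc _ ≤ 2 * (c * ε^2 / (8 * B)) * (2 * B) := by gcongr
        _ = _ := by field_simp; ring
    have h5 : inner ℝ (N (u n) - N (u k)) (T (u n - u k)) ≤ c * ε^2 / 2 := by
      refine (real_inner_le_norm _ _).trans ?_
      have a1 : ‖N (u n) - N (u k)‖ ≤ S := by
        linarith [norm_sub_le (N (u n)) (N (u k)), hNb' n, hNb' k]
      calc _ ≤ S * (c * ε^2 / S / 2) := by
            gcongr
            exact (hsT n hn1 k hk1).le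
        _ = _ := by field_simp
    have h6 : ‖u n - u k‖^2 < ε^2 := by
      have : 0 < c * ε^2 := by positivity
      by_contra hcon
      push Not at hcon
      nlinarith
    rw [dist_eq_norm]
    exact lt_of_pow_lt_pow_left₀ 2 hε.le h6
  obtain ⟨g, hgl⟩ := CompleteSpace.complete hcau
  have hgl : Tendsto u U (𝓝 g) := hgl
  have hG0 : G g = 0 := tendsto_nhds_unique ((hGc.tendsto g).comp hgl) (hGu.mono_left hUle)
  have hφc : Continuous φ := continuous_iff_continuousAt.2 fun u => (hder u).continuousAt
  have hφg : ρ ≤ φ g := ge_of_tendsto' ((hφc.tendsto g).comp hgl) hu1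
  refine ⟨g, ?_, fun h => ⟨(abs_inner_N hTM hf hg g h).1, ?_⟩⟩
  · rintro rfl
    rw [hφ0] at hφg
    linarith
  · have := hinG g h
    rw [hG0, inner_zero_left, (abs_inner_N hTM hf hg g h).2] at this
    linarith

end abstractPart2

/-- difference quotient -/
def DD (u : ℝ → ℝ) : ℝ × ℝ → ℝ := fun p => (u p.1 - u p.2) / |p.1 - p.2|

theorem gagKer_eq (u : ℝ → ℝ) : gagKer u = fun p => (DD u p)^2 := by
  funext p; simp [gagKer, DD, div_pow]

theorem innerKer_eq (u v : ℝ → ℝ) : innerKer u v = fun p => DD u p * DD v p := by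
  funext p; simp only [innerKer, DD]; rw [div_mul_div_comm, sq]

theorem DD_measurable {u : ℝ → ℝ} (hu : Measurable u) : Measurable (DD u) := by
  unfold DD; fun_prop

theorem DD_memLp {u : ℝ → ℝ} (hu : memX u) : MemLp (DD u) 2 (volume : Measure (ℝ × ℝ)) := by
  rw [memLp_two_iff_integrable_sq (DD_measurable hu.1.1).aestronglyMeasurable, ← gagKer_eq]
  exact hu.1.2.2

theorem memX_memLp {u : ℝ → ℝ} (hu : memX u) : MemLp u 2 (volume : Measure ℝ) :=
  (memLp_two_iff_integrable_sq hu.1.1.aestronglyMeasurable).2 hu.1.2.1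

theorem memX_of {u : ℝ → ℝ} (h1 : Measurable u) (h2 : MemLp u 2 (volume : Measure ℝ))
    (h3 : MemLp (DD u) 2 (volume : Measure (ℝ × ℝ))) (h4 : ∀ᵐ x : ℝ, x ∉ Ioo (0 : ℝ) 1 → u x = 0) :
    memX u := by
  refine ⟨⟨h1, (memLp_two_iff_integrable_sq h1.aestronglyMeasurable).1 h2, ?_⟩, h4⟩
  rw [gagKer_eq]
  exact (memLp_two_iff_integrable_sq (DD_measurable h1).aestronglyMeasurable).1 h3

theorem DD_add (u v : ℝ → ℝ) : DD (fun x => u x + v x) = DD u + DD v := by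
  funext p; simp only [DD, Pi.add_apply]; ring

theorem DD_smul (c : ℝ) (u : ℝ → ℝ) : DD (fun x => c * u x) = c • DD u := by
  funext p; simp only [DD, Pi.smul_apply, smul_eq_mul]; ring

theorem memX_add {u v : ℝ → ℝ} (hu : memX u) (hv : memX v) : memX (fun x => u x + v x) := by
  refine memX_of (hu.1.1.add hv.1.1) ((memX_memLp hu).add (memX_memLp hv)) ?_ ?_
  · rw [DD_add]; exact (DD_memLp hu).add (DD_memLp hv)
  · filter_upwards [hu.2, hv.2] with x h1 h2 h3
    rw [h1 h3, h2 h3, add_zero]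

theorem memX_smul (c : ℝ) {u : ℝ → ℝ} (hu : memX u) : memX (fun x => c * u x) := by
  refine memX_of (hu.1.1.const_mul c) ((memX_memLp hu).const_mul c) ?_ ?_
  · rw [DD_smul]; exact (DD_memLp hu).const_smul c
  · filter_upwards [hu.2] with x h1 h3
    rw [h1 h3, mul_zero]

theorem memX_zero : memX (fun _ => 0) := by
  refine memX_of measurable_const MemLp.zero ?_ (Eventually.of_forall fun _ _ => rfl)
  have : DD (fun _ => 0) = 0 := by funext p; simp [DD]
  rw [this]; exact MemLp.zero

theorem gagSq_eq (u : ℝ → ℝ) : gagSq u = ∫ p, (DD u p)^2 := by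
  unfold gagSq; rw [gagKer_eq]

theorem gagSq_nonneg (u : ℝ → ℝ) : 0 ≤ gagSq u := by
  rw [gagSq_eq]; exact integral_nonneg fun p => sq_nonneg _

theorem gagSq_smul (c : ℝ) (u : ℝ → ℝ) : gagSq (fun x => c * u x) = c^2 * gagSq u := by
  rw [gagSq_eq, gagSq_eq, DD_smul, ← integral_const_mul]
  refine integral_congr_ae (Eventually.of_forall fun p => ?_)
  simp only [Pi.smul_apply, smul_eq_mul]; ring

theorem memX_int {u : ℝ → ℝ} (hu : memX u) : ∫ x in Ioo (0:ℝ) 1, (u x)^2 = ∫ x, (u x)^2 := by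
  refine setIntegral_eq_integral_of_ae_compl_eq_zero ?_
  filter_upwards [hu.2] with x h1 h2
  rw [h1 h2]; simp

theorem memX_poincare {u : ℝ → ℝ} (hu : memX u) : lam1 * ∫ x, (u x)^2 ≤ gagSq u := by
  have hJ : 0 ≤ ∫ x, (u x)^2 := integral_nonneg fun p => sq_nonneg _
  rcases hJ.eq_or_lt with h | h
  · rw [← h, mul_zero]; exact gagSq_nonneg u
  set J := ∫ x, (u x)^2 with hJd
  have hs : (√J)^2 = J := Real.sq_sqrt h.le
  have hmem := memX_smul (√J)⁻¹ hu
  have h1 : lam1 ≤ gagSq (fun x => (√J)⁻¹ * u x) := by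
    refine csInf_le ⟨0, ?_⟩ ⟨_, hmem, ?_, rfl⟩
    · rintro _ ⟨v, -, -, rfl⟩; exact gagSq_nonneg v
    · rw [memX_int hmem]
      simp only [mul_pow]
      rw [integral_const_mul, inv_pow, hs, ← hJd, inv_mul_cancel₀ h.ne']
  rw [gagSq_smul, inv_pow, hs, inv_mul_eq_div, le_div_iff₀ h] at h1
  exact h1

theorem memX_uniq (hl : 0 < lam1) {u v : ℝ → ℝ} (hu : memX u) (hv : memX v)
    (h : DD u =ᵐ[volume] DD v) : u =ᵐ[volume] v := by
  have hw := memX_add hu (memX_smul (-1) hv)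
  have h1 := memX_poincare hw
  have h2 : gagSq (fun x => u x + -1 * v x) = 0 := by
    rw [gagSq_eq, DD_add, DD_smul]
    refine integral_eq_zero_of_ae ?_
    filter_upwards [h] with p hp
    simp [hp]
  have h3 : ∫ x, (u x + -1 * v x)^2 = 0 := by
    refine le_antisymm ?_ (integral_nonneg fun p => sq_nonneg _)
    rw [h2] at h1
    by_contra hcon
    push Not at hcon
    nlinarith
  rw [integral_eq_zero_iff_of_nonneg (fun p => sq_nonneg _) hw.1.2.1] at h3
  filter_upwards [h3] with x hx
  have : u x + -1 * v x = 0 := by simpa using hx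
  linarith

/-- The concrete space `X` as a subspace of `L²(ℝ²)`. -/
def XS : Submodule ℝ (Lp ℝ 2 (volume : Measure (ℝ × ℝ))) where
  carrier := {g | ∃ u, memX u ∧ g =ᵐ[volume] DD u}
  zero_mem' := ⟨_, memX_zero, by
    filter_upwards [Lp.coeFn_zero ℝ 2 (volume : Measure (ℝ × ℝ))] with p hp
    rw [hp]; simp [DD]⟩
  add_mem' := by
    rintro g h ⟨u, hu, hgu⟩ ⟨v, hv, hhv⟩
    refine ⟨_, memX_add hu hv, ?_⟩
    rw [DD_add]
    exact (Lp.coeFn_add g h).trans (hgu.add hhv)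
  smul_mem' := by
    rintro c g ⟨u, hu, hgu⟩
    refine ⟨_, memX_smul c hu, ?_⟩
    rw [DD_smul]
    exact (Lp.coeFn_smul c g).trans (hgu.const_smul c)

/-- representative -/
def rep (g : XS) : ℝ → ℝ := g.2.choose

theorem rep_memX (g : XS) : memX (rep g) := g.2.choose_spec.1
theorem rep_DD (g : XS) : (g : Lp ℝ 2 (volume : Measure (ℝ × ℝ))) =ᵐ[volume] DD (rep g) :=
  g.2.choose_spec.2

/-- class -/
def cls {u : ℝ → ℝ} (hu : memX u) : XS := ⟨(DD_memLp hu).toLp, u, hu, (DD_memLp hu).coeFn_toLp⟩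

theorem rep_uniq (hl : 0 < lam1) {u : ℝ → ℝ} (hu : memX u) (g : XS)
    (h : (g : Lp ℝ 2 (volume : Measure (ℝ × ℝ))) =ᵐ[volume] DD u) : rep g =ᵐ[volume] u :=
  memX_uniq hl (rep_memX g) hu ((rep_DD g).symm.trans h)

theorem rep_cls (hl : 0 < lam1) {u : ℝ → ℝ} (hu : memX u) : rep (cls hu) =ᵐ[volume] u :=
  rep_uniq hl hu _ (DD_memLp hu).coeFn_toLp

theorem rep_add (hl : 0 < lam1) (g h : XS) : rep (g + h) =ᵐ[volume] rep g + rep h := by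
  refine rep_uniq hl (memX_add (rep_memX g) (rep_memX h)) _ ?_
  rw [DD_add]
  exact (Lp.coeFn_add g.1 h.1).trans ((rep_DD g).add (rep_DD h))

theorem rep_smul (hl : 0 < lam1) (c : ℝ) (g : XS) : rep (c • g) =ᵐ[volume] c • rep g := by
  refine rep_uniq hl (memX_smul c (rep_memX g)) _ ?_
  rw [DD_smul]
  exact (Lp.coeFn_smul c g.1).trans ((rep_DD g).const_smul c)

theorem XS_norm (g : XS) : ‖g‖^2 = gagSq (rep g) := by
  have : ‖g‖ = ‖(g : Lp ℝ 2 (volume : Measure (ℝ × ℝ)))‖ := rfl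
  rw [this, L2_norm_sq, gagSq_eq]
  refine integral_congr_ae ?_
  filter_upwards [rep_DD g] with p hp
  rw [hp]

theorem XS_inner (g h : XS) : inner ℝ g h = innerX (rep g) (rep h) := by
  have : inner ℝ g h = inner ℝ (g : Lp ℝ 2 (volume : Measure (ℝ × ℝ))) h.1 := rfl
  rw [this, L2.inner_def, innerX, innerKer_eq]
  refine integral_congr_ae ?_
  filter_upwards [rep_DD g, rep_DD h] with p hp hq
  rw [hp, hq]
  simp [mul_comm]

theorem rep_memLp (s : Set ℝ) (g : XS) : MemLp (rep g) 2 (volume.restrict s) :=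
  (memX_memLp (rep_memX g)).restrict s

theorem rep_norm (hl : 0 < lam1) (s : Set ℝ) (g : XS) :
    lam1 * ‖(rep_memLp s g).toLp‖^2 ≤ ‖g‖^2 := by
  rw [XS_norm, L2_norm_sq]
  refine le_trans ?_ (memX_poincare (rep_memX g))
  refine mul_le_mul_of_nonneg_left ?_ hl.le
  have : ∫ x in s, ((rep_memLp s g).toLp (rep g) x)^2 = ∫ x in s, (rep g x)^2 := by
    refine integral_congr_ae ?_
    filter_upwards [(rep_memLp s g).coeFn_toLp] with x hx
    rw [hx]
  rw [this]
  exact setIntegral_le_integral (rep_memX g).1.2.1 (Eventually.of_forall fun p => sq_nonneg _)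

/-- embedding into `L²` -/
def TT (hl : 0 < lam1) (s : Set ℝ) : XS →L[ℝ] Lp ℝ 2 (volume.restrict s) :=
  LinearMap.mkContinuous
    { toFun := fun g => (rep_memLp s g).toLp
      map_add' := fun g h => by
        rw [← MemLp.toLp_add]
        exact MemLp.toLp_congr _ _ (ae_restrict_of_ae (rep_add hl g h))
      map_smul' := fun c g => by
        rw [RingHom.id_apply, ← MemLp.toLp_const_smul]
        exact MemLp.toLp_congr _ _ (ae_restrict_of_ae (rep_smul hl c g)) }
    (√lam1)⁻¹ (fun g => by
      have h := rep_norm hl s g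
      have hs : 0 < √lam1 := Real.sqrt_pos.2 hl
      rw [inv_mul_eq_div, le_div_iff₀ hs]
      refine abs_le_of_sq_le_sq' ?_ (norm_nonneg _) |>.2
      rw [mul_pow, Real.sq_sqrt hl.le, mul_comm]
      exact h)

theorem TT_coe (hl : 0 < lam1) (s : Set ℝ) (g : XS) : TT hl s g =ᵐ[volume.restrict s] rep g :=
  (rep_memLp s g).coeFn_toLp

theorem TT_norm (hl : 0 < lam1) (s : Set ℝ) (g : XS) : lam1 * ‖TT hl s g‖^2 ≤ ‖g‖^2 :=
  rep_norm hl s g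

theorem XS_closed (hl : 0 < lam1) : IsClosed (XS : Set (Lp ℝ 2 (volume : Measure (ℝ × ℝ)))) := by
  refine IsSeqClosed.isClosed ?_
  intro g G hg hG
  set γ : ℕ → XS := fun n => ⟨g n, hg n⟩ with hγ
  have hc : CauchySeq γ := by
    rw [cauchySeq_iff_le_tendsto_0]
    have hc0 := hG.cauchySeq
    rw [cauchySeq_iff_le_tendsto_0] at hc0
    exact hc0
  have hT : CauchySeq (fun n => TT hl univ (γ n)) := (TT hl univ).uniformContinuous.comp_cauchySeq hc
  obtain ⟨W, hW⟩ := cauchySeq_tendsto_of_complete hT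
  obtain ⟨n1, hn1, hae1⟩ := (tendstoInMeasure_of_tendsto_Lp hW).exists_seq_tendsto_ae
  obtain ⟨n2, hn2, hae2⟩ := (tendstoInMeasure_of_tendsto_Lp
    (hG.comp hn1.tendsto_atTop)).exists_seq_tendsto_ae
  have hmle : (volume : Measure ℝ) ≤ volume.restrict univ := Measure.restrict_univ.ge
  have hle : ae (volume : Measure ℝ) ≤ ae (volume.restrict univ) := ae_mono hmle
  have hae1 := hle hae1
  have hWm : AEStronglyMeasurable W (volume : Measure ℝ) :=
    (Lp.aestronglyMeasurable W).mono_measure hmle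
  have hWL : MemLp W 2 (volume : Measure ℝ) := (Lp.memLp W).mono_measure hmle
  set w0 := hWm.mk W with hw0
  have hw0m : Measurable w0 := hWm.stronglyMeasurable_mk.measurable
  have hlim : ∀ᵐ x : ℝ, Tendsto (fun k => rep (γ (n1 (n2 k))) x) atTop (𝓝 (w0 x)) := by
    have h1 : ∀ᵐ x : ℝ, ∀ k, TT hl univ (γ (n1 (n2 k))) x = rep (γ (n1 (n2 k))) x := by
      rw [ae_all_iff]
      intro k
      exact hle (TT_coe hl univ (γ (n1 (n2 k))))
    filter_upwards [h1, hae1, hWm.ae_eq_mk] with x hx1 hx2 hx3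
    rw [hw0, ← hx3]
    simp only [← hx1]
    exact hx2.comp hn2.tendsto_atTop
  have hq1 : Measure.QuasiMeasurePreserving Prod.fst (volume : Measure (ℝ × ℝ)) (volume : Measure ℝ) :=
    Measure.quasiMeasurePreserving_fst
  have hq2 : Measure.QuasiMeasurePreserving Prod.snd (volume : Measure (ℝ × ℝ)) (volume : Measure ℝ) :=
    Measure.quasiMeasurePreserving_snd
  have hGw : G =ᵐ[volume] DD w0 := by
    have h1 : ∀ᵐ p : ℝ × ℝ, ∀ k, g (n1 (n2 k)) p = DD (rep (γ (n1 (n2 k)))) p := by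
      rw [ae_all_iff]
      intro k
      exact rep_DD (γ (n1 (n2 k)))
    filter_upwards [h1, hae2, hq1.ae hlim, hq2.ae hlim] with p hp1 hp2 hp3 hp4
    refine tendsto_nhds_unique hp2 ?_
    simp only [Function.comp, hp1]
    exact (hp3.sub hp4).div_const _
  refine ⟨w0, memX_of hw0m (hWL.ae_eq hWm.ae_eq_mk) ((Lp.memLp G).ae_eq hGw) ?_, hGw⟩
  have h1 : ∀ᵐ x : ℝ, ∀ k, x ∉ Ioo (0:ℝ) 1 → rep (γ (n1 (n2 k))) x = 0 := by
    rw [ae_all_iff]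
    intro k
    exact (rep_memX _).2
  filter_upwards [h1, hlim] with x hx1 hx2 hx
  refine tendsto_nhds_unique hx2 ?_
  simp only [fun k => hx1 k hx]
  exact tendsto_const_nhds

theorem local_poincare {I : Set ℝ} (hI : MeasurableSet I) {h : ℝ} (hh : 0 < h)
    (hv : volume I = ENNReal.ofReal h) (hd : ∀ x ∈ I, ∀ y ∈ I, |x - y| ≤ h) {u : ℝ → ℝ}
    (hu : memX u) :
    2 * h * ∫ x in I, (u x)^2 ≤ 2 * (∫ x in I, u x)^2 + h^2 * ∫ p in I ×ˢ I, gagKer u p := by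
  set μ := (volume : Measure ℝ).restrict I with hμ
  have : IsFiniteMeasure μ := ⟨by rw [hμ, Measure.restrict_apply_univ, hv]; exact ENNReal.ofReal_lt_top⟩
  have hμr : μ.real univ = h := by
    rw [hμ, measureReal_def, Measure.restrict_apply_univ, hv, ENNReal.toReal_ofReal hh.le]
  have hprod : (volume : Measure (ℝ × ℝ)).restrict (I ×ˢ I) = μ.prod μ := by
    rw [hμ, Measure.prod_restrict]; rfl
  have hu2 : Integrable (fun x => (u x)^2) μ := hu.1.2.1.integrableOn
  have hu1 : Integrable u μ := ((memX_memLp hu).restrict I).integrable (by norm_num)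
  have i1 : Integrable (fun p : ℝ × ℝ => (u p.1)^2 * 1) (μ.prod μ) :=
    hu2.mul_prod (integrable_const (1:ℝ))
  have i2 : Integrable (fun p : ℝ × ℝ => 1 * (u p.2)^2) (μ.prod μ) :=
    (integrable_const (1:ℝ)).mul_prod hu2
  have i3 : Integrable (fun p : ℝ × ℝ => u p.1 * u p.2) (μ.prod μ) := hu1.mul_prod hu1
  have hk : Integrable (gagKer u) (μ.prod μ) := by
    rw [← hprod]; exact hu.1.2.2.integrableOn
  have e1 : ∫ p, ((u p.1)^2 * 1 + 1 * (u p.2)^2 - 2 * (u p.1 * u p.2)) ∂(μ.prod μ) =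
      2 * h * ∫ x, (u x)^2 ∂μ - 2 * (∫ x, u x ∂μ)^2 := by
    have i12 : Integrable (fun p : ℝ × ℝ => (u p.1)^2 * 1 + 1 * (u p.2)^2) (μ.prod μ) := i1.add i2
    rw [integral_sub i12 (i3.const_mul 2), integral_add i1 i2, integral_const_mul 2 (fun p : ℝ × ℝ => u p.1 * u p.2),
      integral_prod_mul (fun x => (u x)^2) (fun _ => (1:ℝ)),
      integral_prod_mul (fun _ => (1:ℝ)) (fun x => (u x)^2), integral_prod_mul u u]
    simp only [integral_const, hμr, smul_eq_mul]
    ring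
  have e2 : ∫ p, ((u p.1)^2 * 1 + 1 * (u p.2)^2 - 2 * (u p.1 * u p.2)) ∂(μ.prod μ) ≤
      ∫ p, h^2 * gagKer u p ∂(μ.prod μ) := by
    refine integral_mono_ae ((i1.add i2).sub (i3.const_mul 2)) (hk.const_mul _) ?_
    rw [← hprod]
    filter_upwards [ae_restrict_mem (hI.prod hI)] with p hp
    have e3 : (u p.1)^2 * 1 + 1 * (u p.2)^2 - 2 * (u p.1 * u p.2) = (u p.1 - u p.2)^2 := by ring
    simp only [e3]
    by_cases hpp : p.1 = p.2
    · rw [hpp]; simp [gagKer, hpp]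
    · have hpos : 0 < |p.1 - p.2| := abs_pos.2 (sub_ne_zero.2 hpp)
      have hle := hd p.1 hp.1 p.2 hp.2
      simp only [gagKer]
      rw [mul_div_assoc', le_div_iff₀ (by positivity), mul_comm]
      gcongr
  rw [integral_const_mul] at e2
  rw [hprod]
  linarith

/-- pieces of the unit interval -/
def piece (k : ℕ) (i : Fin (k+1)) : Set ℝ :=
  Ioc ((i:ℝ) / (k+1)) (((i:ℝ)+1) / (k+1)) ∩ Ioo 0 1

theorem piece_meas (k : ℕ) (i : Fin (k+1)) : MeasurableSet (piece k i) :=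
  measurableSet_Ioc.inter measurableSet_Ioo

theorem piece_vol (k : ℕ) (i : Fin (k+1)) : volume (piece k i) = ENNReal.ofReal (1 / ((k:ℝ)+1)) := by
  have h1 : piece k i =ᵐ[volume] (Ioc ((i:ℝ) / (k+1)) (((i:ℝ)+1) / (k+1)) ∩ Ioc 0 1 : Set ℝ) :=
    (ae_eq_refl _).inter Ioo_ae_eq_Ioc
  have hk : (0:ℝ) < k + 1 := by positivity
  have h2 : (Ioc ((i:ℝ) / (k+1)) (((i:ℝ)+1) / (k+1)) ∩ Ioc 0 1 : Set ℝ) =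
      Ioc ((i:ℝ) / (k+1)) (((i:ℝ)+1) / (k+1)) := by
    refine inter_eq_left.2 (Ioc_subset_Ioc (by positivity) ?_)
    rw [div_le_one hk]
    have : (i:ℕ) + 1 ≤ k + 1 := i.2
    exact_mod_cast this
  rw [measure_congr h1, h2, Real.volume_Ioc]
  congr 1
  ring

theorem piece_diam (k : ℕ) (i : Fin (k+1)) : ∀ x ∈ piece k i, ∀ y ∈ piece k i,
    |x - y| ≤ 1 / ((k:ℝ)+1) := by
  intro x hx y hy
  have e : ((i:ℝ)+1) / (k+1) = (i:ℝ) / (k+1) + 1 / ((k:ℝ)+1) := by ring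
  have hx1 := hx.1.1
  have hx2 := hx.1.2
  have hy1 := hy.1.1
  have hy2 := hy.1.2
  rw [abs_le]
  constructor <;> linarith

theorem piece_disj (k : ℕ) : Pairwise (Function.onFun Disjoint (piece k)) := by
  intro i j hij
  rw [Function.onFun, Set.disjoint_left]
  intro x hx hy
  apply hij
  have hk : (0:ℝ) < k + 1 := by positivity
  have a1 := hx.1.1
  have a2 := hx.1.2
  have b1 := hy.1.1
  have b2 := hy.1.2
  rw [div_lt_iff₀ hk] at a1 b1
  rw [le_div_iff₀ hk] at a2 b2
  have c1 : (i:ℕ) < (j:ℕ) + 1 := by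
    have : (i:ℝ) < (j:ℝ) + 1 := by linarith
    exact_mod_cast this
  have c2 : (j:ℕ) < (i:ℕ) + 1 := by
    have : (j:ℝ) < (i:ℝ) + 1 := by linarith
    exact_mod_cast this
  apply Fin.ext
  omega

theorem piece_union (k : ℕ) : ⋃ i, piece k i = Ioo 0 1 := by
  apply Subset.antisymm
  · exact iUnion_subset fun i => inter_subset_right
  · intro x hx
    have hk : (0:ℝ) < k + 1 := by positivity
    have h0 : 0 < x * (k+1) := mul_pos hx.1 hk
    have h1 : x * (k+1) ≤ ((k+1 : ℕ) : ℝ) := by push_cast; nlinarith [hx.2]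
    have h2 : ⌈x * (k+1)⌉₊ ≤ k + 1 := Nat.ceil_le.2 h1
    have h3 : 0 < ⌈x * (k+1)⌉₊ := Nat.ceil_pos.2 h0
    obtain ⟨n, hn⟩ : ∃ n, ⌈x * (k+1)⌉₊ = n + 1 := ⟨⌈x * (k+1)⌉₊ - 1, by omega⟩
    refine mem_iUnion.2 ⟨⟨n, by omega⟩, ⟨?_, ?_⟩, hx⟩
    · rw [div_lt_iff₀ hk]
      exact Nat.lt_ceil.1 (by rw [hn]; exact Nat.lt_succ_self n)
    · rw [le_div_iff₀ hk]
      have := Nat.le_ceil (x * ((k:ℝ)+1))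
      rw [hn] at this
      push_cast at this
      exact this

theorem sum_poincare (k : ℕ) {u : ℝ → ℝ} (hu : memX u) :
    ∫ x in Ioo (0:ℝ) 1, (u x)^2 ≤ 1 / ((k:ℝ)+1) / 2 * gagSq u +
      ((k:ℝ)+1) * ∑ i, (∫ x in piece k i, u x)^2 := by
  have hk : (0:ℝ) < k + 1 := by positivity
  set h := 1 / ((k:ℝ)+1) with hh
  have hp : 0 < h := by positivity
  have h1 : ∀ i, _ := fun i => local_poincare (piece_meas k i) hp (piece_vol k i) (piece_diam k i) hu
  have h2 := Finset.sum_le_sum fun i (_ : i ∈ Finset.univ) => h1 i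
  rw [← Finset.mul_sum, Finset.sum_add_distrib, ← Finset.mul_sum, ← Finset.mul_sum] at h2
  have h3 : ∑ i, ∫ x in piece k i, (u x)^2 = ∫ x in Ioo (0:ℝ) 1, (u x)^2 := by
    rw [← piece_union k, integral_iUnion_fintype (piece_meas k) (piece_disj k)
      (fun i => hu.1.2.1.integrableOn)]
  have h4 : ∑ i, ∫ p in piece k i ×ˢ piece k i, gagKer u p ≤ gagSq u := by
    rw [← integral_iUnion_fintype (fun i => (piece_meas k i).prod (piece_meas k i)) ?_
      (fun i => hu.1.2.2.integrableOn)]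
    · refine setIntegral_le_integral hu.1.2.2 (Eventually.of_forall fun p => ?_)
      rw [gagKer_eq]; exact sq_nonneg _
    · intro i j hij
      exact Set.disjoint_prod.2 (Or.inl (piece_disj k hij))
  rw [h3] at h2
  have h5 : ((k:ℝ)+1) * h = 1 := by rw [hh]; field_simp
  set S := ∑ i, (∫ x in piece k i, u x)^2
  set J := ∫ x in Ioo (0:ℝ) 1, (u x)^2
  have h6 : 2 * h * J ≤ 2 * S + h^2 * gagSq u := h2.trans (by gcongr)
  have h7 := mul_le_mul_of_nonneg_left h6 hk.le
  have e1 : ((k:ℝ)+1) * (2 * h * J) = 2 * J := by linear_combination 2 * J * h5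
  have e2 : ((k:ℝ)+1) * (2 * S + h^2 * gagSq u) = 2 * (((k:ℝ)+1) * S) + h * gagSq u := by
    linear_combination h * gagSq u * h5
  rw [e1, e2] at h7
  linarith

instance unitProb : IsProbabilityMeasure ((volume : Measure ℝ).restrict (Ioo 0 1)) :=
  ⟨by simp⟩

theorem TT_comp (hl : 0 < lam1) : AbsComp (TT hl (Ioo 0 1)) := by
  intro ε hε
  obtain ⟨k, hk⟩ := exists_nat_one_div_lt hε
  have hkp : (0:ℝ) < k + 1 := by positivity
  refine ⟨k + 1, fun i => indicatorConstLp 2 (piece_meas k i) (measure_ne_top _ _) (1:ℝ), k + 1, hkp,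
    fun g => ?_⟩
  have h1 := sum_poincare k (rep_memX g)
  have h2 : ‖TT hl (Ioo 0 1) g‖^2 = ∫ x in Ioo (0:ℝ) 1, (rep g x)^2 := by
    rw [L2_norm_sq]
    refine integral_congr_ae ?_
    filter_upwards [TT_coe hl (Ioo 0 1) g] with x hx
    rw [hx]
  have h3 : ∀ i, inner ℝ (indicatorConstLp 2 (piece_meas k i)
      (measure_ne_top ((volume : Measure ℝ).restrict (Ioo 0 1)) _) (1:ℝ)) (TT hl (Ioo 0 1) g) =
      ∫ x in piece k i, rep g x := by
    intro i
    rw [L2.inner_indicatorConstLp_one]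
    have hr : ((volume : Measure ℝ).restrict (Ioo 0 1)).restrict (piece k i) = volume.restrict (piece k i) :=
      Measure.restrict_restrict_of_subset inter_subset_right
    rw [integral_congr_ae (ae_restrict_of_ae (TT_coe hl (Ioo 0 1) g)), hr]
  rw [h2]
  simp only [h3]
  refine h1.trans ?_
  rw [XS_norm]
  have := gagSq_nonneg (rep g)
  have : 1 / ((k:ℝ)+1) / 2 * gagSq (rep g) ≤ ε * gagSq (rep g) := by
    refine mul_le_mul_of_nonneg_right ?_ this
    linarith
  linarith

theorem TT_TM (hl : 0 < lam1) {ω : ℝ} (hω : 0 < ω) (hTM : TMprop ω) : AbsTM (TT hl (Ioo 0 1)) := by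
  intro B hB
  have hpi := Real.pi_pos
  obtain ⟨K, hK, h⟩ := hTM (π * ω) (by positivity) (by nlinarith [mul_pos hpi hω])
  refine ⟨π * ω / B^2, by positivity, K, hK, fun g hg => ?_⟩
  have hm := memX_smul B⁻¹ (rep_memX g)
  have h1 : gagNorm (fun x => B⁻¹ * rep g x) ≤ 1 := by
    unfold gagNorm
    rw [gagSq_smul, ← XS_norm, ← mul_pow, Real.sqrt_sq (by positivity), inv_mul_eq_div, div_le_one hB]
    exact hg
  have h2 := h _ hm h1
  have hae : (fun x => exp (π * ω / B^2 * (TT hl (Ioo 0 1) g x)^2)) =ᵐ[volume.restrict (Ioo 0 1)]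
      fun x => exp (π * ω * (B⁻¹ * rep g x)^2) := by
    filter_upwards [TT_coe hl (Ioo 0 1) g] with x hx
    rw [hx]; congr 1; field_simp
  have hmeas : Measurable (fun x => exp (π * ω * (B⁻¹ * rep g x)^2)) := by
    have := (rep_memX g).1.1
    fun_prop
  have hi : Integrable (fun x => exp (π * ω * (B⁻¹ * rep g x)^2)) (volume.restrict (Ioo 0 1)) := by
    refine ⟨hmeas.aestronglyMeasurable, ?_⟩
    rw [hasFiniteIntegral_iff_ofReal (Eventually.of_forall fun x => (exp_pos _).le)]
    exact h2.trans_lt ENNReal.ofReal_lt_top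
  refine ⟨hi.congr hae.symm, ?_⟩
  rw [integral_congr_ae hae, integral_eq_lintegral_of_nonneg_ae (Eventually.of_forall fun x => (exp_pos _).le)
    hmeas.aestronglyMeasurable]
  exact ENNReal.toReal_le_of_le_ofReal hK.le h2

theorem exists_g0 (hl : 0 < lam1) : ∃ g : XS, TT hl (Ioo 0 1) g ≠ 0 := by
  by_cases hne : { t : ℝ | ∃ u : ℝ → ℝ, memX u ∧ (∫ x in Ioo (0 : ℝ) 1, (u x) ^ 2) = 1 ∧ gagSq u = t }.Nonempty
  · obtain ⟨_, u, hu, h1, -⟩ := hne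
    refine ⟨cls hu, fun h0 => ?_⟩
    have h2 : ‖TT hl (Ioo 0 1) (cls hu)‖^2 = 1 := by
      rw [L2_norm_sq]
      refine Eq.trans (integral_congr_ae ?_) h1
      filter_upwards [TT_coe hl (Ioo 0 1) (cls hu), ae_restrict_of_ae (rep_cls hl hu)] with x hx hy
      rw [hx, hy]
    rw [h0, norm_zero] at h2
    norm_num at h2
  · exfalso
    rw [Set.not_nonempty_iff_eq_empty] at hne
    unfold lam1 at hl
    rw [hne, Real.sInf_empty] at hl
    exact lt_irrefl _ hl

/-- subcritical existence (Theorem 1, existence part). -/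
theorem statement0 (ω : ℝ) (hω0 : 0 < ω) (hωπ : ω ≤ π) (hTM : TMprop ω)
    (f : ℝ → ℝ) (hf : HypH f) :
    ∃ u : ℝ → ℝ, IsWeakSolution f u ∧ ¬ (u =ᵐ[volume] (fun _ => (0 : ℝ))) := by
  obtain ⟨hfc, hf0, ⟨t₀, ht₀, M, hM, h1⟩, h2, h3, h4⟩ := hf
  have hpi := Real.pi_pos
  obtain ⟨hl4, m, hml, hm, δ, hδ, hsm⟩ := limsup_facts hfc h2 _ h3
  have hl : 0 < lam1 := by
    have := mul_pos hl4 (show 0 < 4 * π by positivity)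
    rwa [div_mul_cancel₀ _ (by positivity)] at this
  have hg := growth_of_tendsto hfc h4
  have hG := growth_F hg h2
  have : CompleteSpace XS := (XS_closed hl).completeSpace_coe
  obtain ⟨g0, hg0⟩ := exists_g0 hl
  obtain ⟨g, hg1, hg2⟩ := abs_existence (TT_TM hl hω0 hTM) (TT_comp hl) hfc hg hG (1 / (4 * π)) lam1 m
    (by positivity) hl hm (by rw [one_div_mul_eq_div]; exact hml)
    (F_small hG m δ hm hδ hsm) (TT_norm hl _)
    (fun L hL => F_big hfc t₀ M hM h1 h2 L hL) (AR_bound hfc t₀ M hM h1 h2) g0 hg0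
  refine ⟨rep g, ⟨rep_memX g, fun v hv => ?_⟩, fun h0 => hg1 ?_⟩
  · obtain ⟨a1, a2⟩ := hg2 (cls hv)
    have hae : (fun x => f (TT hl (Ioo 0 1) g x) * TT hl (Ioo 0 1) (cls hv) x)
        =ᵐ[volume.restrict (Ioo 0 1)] fun x => f (rep g x) * v x := by
      filter_upwards [TT_coe hl (Ioo 0 1) g, TT_coe hl (Ioo 0 1) (cls hv),
        ae_restrict_of_ae (rep_cls hl hv)] with x hx hy hz
      rw [hx, hy, hz]
    refine ⟨a1.congr hae, ?_⟩
    rw [integral_congr_ae hae, XS_inner] at a2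
    have a3 : innerX (rep g) (rep (cls hv)) = innerX (rep g) v := by
      unfold innerX
      rw [innerKer_eq, innerKer_eq]
      refine integral_congr_ae ?_
      filter_upwards [(rep_DD (cls hv)).symm.trans (DD_memLp hv).coeFn_toLp] with p hp
      rw [hp]
    rw [← a2, a3]
    field_simp
    ring
  · have : ‖g‖^2 = 0 := by
      rw [XS_norm]
      have hq : (volume : Measure (ℝ × ℝ)) = (volume : Measure ℝ).prod volume := rfl
      have hq1 : Measure.QuasiMeasurePreserving Prod.fst (volume : Measure (ℝ × ℝ)) (volume : Measure ℝ) :=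
        Measure.quasiMeasurePreserving_fst
      have hq2 : Measure.QuasiMeasurePreserving Prod.snd (volume : Measure (ℝ × ℝ)) (volume : Measure ℝ) :=
        Measure.quasiMeasurePreserving_snd
      refine integral_eq_zero_of_ae ?_
      filter_upwards [hq1.ae h0, hq2.ae h0] with p hp1 hp2
      simp [gagKer, hp1, hp2]
    exact norm_eq_zero.1 (pow_eq_zero_iff (two_ne_zero)|>.1 this)
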